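/- For all positive integers d and k, there exists a cactus CT with girth at least k, cycle-distance at least d, and game chromatic number exactly 5. -/

import Mathlib

namespace GCN

/-- The player whose turn it is. -/
inductive Player : Type
  | alice : Player
  | bob : Player

variable {V α : Type}

/-- A move consisting of coloring the uncolored vertex `v` with color `a` is legal in the
partial coloring `c` if `v` is uncolored and no neighbor of `v` has color `a`. -/
def legalMove (G : SimpleGraph V) (c : V → Option α) (v : V) (a : α) : Prop :=
  c v = none ∧ ∀ u, G.Adj v u → c u ≠ some a

/-- The partial coloring obtained by coloring vertex `v` with color `a`. -/
def applyMove [DecidableEq V] (c : V → Option α) (v : V) (a : α) : V → Option α :=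
  Function.update c v (some a)

/-- `BobWins G p c` : in the coloring game on `G` starting from the partial coloring `c` with
player `p` to move (the moving player must color an uncolored vertex properly whenever a legal
move exists; the game ends when no legal move exists), Bob has a strategy guaranteeing that the
game ends with some vertex uncolored. -/
inductive BobWins [DecidableEq V] (G : SimpleGraph V) : Player → (V → Option α) → Prop
  | endPos (p : Player) (c : V → Option α)
      (hend : ∀ v a, ¬ legalMove G c v a) (hunc : ∃ v, c v = none) : BobWins G p c
  | aliceMove (c : V → Option α)
      (hmoves : ∃ v a, legalMove G c v a)
      (h : ∀ v a, legalMove G c v a → BobWins G .bob (applyMove c v a)) :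
      BobWins G .alice c
  | bobMove (c : V → Option α) (v : V) (a : α)
      (hmove : legalMove G c v a)
      (h : BobWins G .alice (applyMove c v a)) : BobWins G .bob c

/-- `AliceWins G p c` : in the coloring game on `G` starting from the partial coloring `c` with
player `p` to move, Alice has a strategy guaranteeing that the game ends with all vertices
colored. -/
inductive AliceWins [DecidableEq V] (G : SimpleGraph V) : Player → (V → Option α) → Prop
  | endPos (p : Player) (c : V → Option α)
      (hend : ∀ v a, ¬ legalMove G c v a) (hall : ∀ v, c v ≠ none) : AliceWins G p c
  | aliceMove (c : V → Option α) (v : V) (a : α)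
      (hmove : legalMove G c v a)
      (h : AliceWins G .bob (applyMove c v a)) : AliceWins G .alice c
  | bobMove (c : V → Option α)
      (hmoves : ∃ v a, legalMove G c v a)
      (h : ∀ v a, legalMove G c v a → AliceWins G .alice (applyMove c v a)) :
      AliceWins G .bob c

/-- The game chromatic number of `G` : the least number `k` of colors such that Alice has a
winning strategy in the coloring game on `G` played with `k` colors (Alice moving first,
starting from the everywhere-uncolored position). -/
noncomputable def gameChromaticNumber [DecidableEq V] (G : SimpleGraph V) : ℕ :=
  sInf {k : ℕ | AliceWins (α := Fin k) G .alice (fun _ => none)}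

/-- `c` is a partial proper coloring of `G` : adjacent colored vertices get distinct colors. -/
def ProperPartial (G : SimpleGraph V) (c : V → Option α) : Prop :=
  ∀ ⦃u v : V⦄, G.Adj u v → ∀ a : α, c u = some a → c v ≠ some a

/-- `Phi G c v` : the set of colors appearing (under `c`) on the neighbors of `v`. -/
def Phi (G : SimpleGraph V) (c : V → Option α) (v : V) : Set α :=
  {a : α | ∃ u, G.Adj v u ∧ c u = some a}

end GCN

namespace GCN

/-- A cactus is a graph in which every edge belongs to at most one cycle; equivalently, any two
cycles sharing an edge have the same edge set. -/
def IsCactus {V : Type} (G : SimpleGraph V) : Prop :=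
  ∀ ⦃u v : V⦄ (c₁ : G.Walk u u) (c₂ : G.Walk v v), c₁.IsCycle → c₂.IsCycle →
    ∀ e : Sym2 V, e ∈ c₁.edges → e ∈ c₂.edges →
      ∀ e' : Sym2 V, e' ∈ c₁.edges ↔ e' ∈ c₂.edges

/-- The cycle-distance of a graph : the minimum length of a path whose two endpoints lie on
two different cycles (cycles being identified with their edge sets), as an `ℕ∞`. -/
noncomputable def cycleDistance {V : Type} (G : SimpleGraph V) : ℕ∞ :=
  ⨅ (u : V) (v : V) (c₁ : G.Walk u u) (c₂ : G.Walk v v) (_ : c₁.IsCycle) (_ : c₂.IsCycle)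
    (_ : ¬ ∀ e : Sym2 V, e ∈ c₁.edges ↔ e ∈ c₂.edges) (P : G.Walk u v) (_ : P.IsPath),
    (P.length : ℕ∞)

end GCN

namespace GCN

/-- The colours forbidden at each vertex after the colour `a` has been added at `v`. -/
def addColor {W : Type} (Φ : W → Set ℕ) (v : W) (a : ℕ) : W → Set ℕ :=
  fun y => {b | b ∈ Φ y ∨ (y = v ∧ b = a)}

/-- The colours forbidden at each vertex after `w` has been coloured `g`. -/
def spread {W : Type} (H : SimpleGraph W) (Φ : W → Set ℕ) (w : W) (g : ℕ) : W → Set ℕ :=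
  fun y => {b | b ∈ Φ y ∨ (H.Adj w y ∧ b = g)}

/-- The core game: `U` is the set of uncoloured vertices and `Φ` records forbidden colours among
`0, …, q - 1`. Bob adds forbidden colours, Alice passes or colours a vertex of `U`; Bob wins
when a vertex of `U` has no colour left. `BobForces q H n U Φ` says that Bob, to move, wins
within `n` moves. -/
def BobForces {W : Type} (q : ℕ) (H : SimpleGraph W) : ℕ → Set W → (W → Set ℕ) → Prop
  | 0, U, Φ => ∃ v ∈ U, ∀ a < q, a ∈ Φ v
  | n + 1, U, Φ => (∃ v ∈ U, ∀ a < q, a ∈ Φ v) ∨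
      ∃ v ∈ U, ∃ a < q, BobForces q H n U (addColor Φ v a) ∧
        ∀ w ∈ U, ∀ g < q, g ∉ addColor Φ v a w →
          BobForces q H n (U \ {w}) (spread H (addColor Φ v a) w g)

section
variable {W : Type} {q : ℕ} {H : SimpleGraph W}

theorem BobForces.of_dead {U : Set W} {Φ : W → Set ℕ} {v : W} (hv : v ∈ U)
    (h : ∀ a < q, a ∈ Φ v) : ∀ n, BobForces q H n U Φ
  | 0 => ⟨v, hv, h⟩
  | _ + 1 => Or.inl ⟨v, hv, h⟩

theorem BobForces.succ : ∀ {n : ℕ} {U : Set W} {Φ : W → Set ℕ},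
    BobForces q H n U Φ → BobForces q H (n + 1) U Φ
  | 0, _, _, h => Or.inl h
  | _ + 1, _, _, Or.inl h => Or.inl h
  | _ + 1, _, _, Or.inr ⟨v, hv, a, ha, h₀, h⟩ =>
      Or.inr ⟨v, hv, a, ha, h₀.succ, fun w hw g hg hgw => (h w hw g hg hgw).succ⟩

theorem BobForces.of_le {n m : ℕ} {U : Set W} {Φ : W → Set ℕ}
    (h : BobForces q H n U Φ) (hnm : n ≤ m) : BobForces q H m U Φ := by
  induction hnm with
  | refl => exact h
  | step _ ih => exact ih.succ

/-- Bob wins at once when a vertex has at most one colour left. -/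
theorem BobForces.of_one_left {U : Set W} {Φ : W → Set ℕ} {v : W} {b : ℕ} (hv : v ∈ U)
    (hb : b < q) (h : ∀ a < q, a ∈ Φ v ∨ a = b) (n : ℕ) : BobForces q H (n + 1) U Φ := by
  have key : ∀ a < q, a ∈ addColor Φ v b v := fun a ha => (h a ha).imp id fun h' => ⟨rfl, h'⟩
  refine Or.inr ⟨v, hv, b, hb, .of_dead hv key n, fun w hw g hg hgw => ?_⟩
  have hvw : v ∈ U \ {w} := ⟨hv, by rintro rfl; exact hgw (key g hg)⟩
  exact .of_dead hvw (fun a ha => Or.inl (key a ha)) n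

/-- The sequence `v 0, …, v n` is a path of `H` inside `U`. -/
structure IsRoute (H : SimpleGraph W) (U : Set W) (v : ℕ → W) (n : ℕ) : Prop where
  mem : ∀ i ≤ n, v i ∈ U
  adj : ∀ i < n, H.Adj (v i) (v (i + 1))
  inj : ∀ i ≤ n, ∀ j ≤ n, v i = v j → i = j

theorem IsRoute.reverse {U : Set W} {v : ℕ → W} {n : ℕ} (h : IsRoute H U v n) :
    IsRoute H U (fun i => v (n - i)) n where
  mem i _ := h.mem _ (Nat.sub_le _ _)
  adj i hi := by
    have := h.adj (n - (i + 1)) (by omega)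
    rw [show n - (i + 1) + 1 = n - i by omega] at this
    exact this.symm
  inj i hi j hj hij := by
    have := h.inj _ (Nat.sub_le n i) _ (Nat.sub_le n j) hij
    omega

theorem IsRoute.before {U : Set W} {v : ℕ → W} {n i : ℕ} (h : IsRoute H U v n) (hi : i ≤ n)
    (hi0 : 1 ≤ i) : IsRoute H (U \ {v i}) v (i - 1) where
  mem j hj := ⟨h.mem j (by omega), fun h' => by
    have := h.inj j (by omega) i hi h'
    omega⟩
  adj j hj := h.adj j (by omega)
  inj j hj l hl := h.inj j (by omega) l (by omega)

/-- The winning condition for Bob on a route: two forbidden colours at one end and one at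
the other end, of the right parity. -/
structure Threat (H : SimpleGraph W) (U : Set W) (Φ : W → Set ℕ) (v : ℕ → W) (n c₁ c₂ x : ℕ) :
    Prop extends IsRoute H U v n where
  ne : c₁ ≠ c₂
  lt₁ : c₁ < 4
  lt₂ : c₂ < 4
  ltx : x < 4
  mem₁ : c₁ ∈ Φ (v 0)
  mem₂ : c₂ ∈ Φ (v 0)
  memx : x ∈ Φ (v n)
  parity : n % 2 = 1 ↔ (x = c₁ ∨ x = c₂)

/-- Two ends of a route are blocked by two colours each, in the position where any colouring
by Alice of a vertex of the route leaves a threat. -/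
structure DoubleThreat (H : SimpleGraph W) (U : Set W) (Φ : W → Set ℕ) (v : ℕ → W)
    (n c₁ c₂ b₁ b₂ : ℕ) : Prop extends IsRoute H U v n where
  ne : c₁ ≠ c₂
  lt₁ : c₁ < 4
  lt₂ : c₂ < 4
  ne' : b₁ ≠ b₂
  lt₁' : b₁ < 4
  lt₂' : b₂ < 4
  mem₁ : c₁ ∈ Φ (v 0)
  mem₂ : c₂ ∈ Φ (v 0)
  mem₁' : b₁ ∈ Φ (v n)
  mem₂' : b₂ ∈ Φ (v n)
  parity : ∀ g < 4, n % 2 = 1 ↔ ((g = c₁ ∨ g = c₂) ↔ (g = b₁ ∨ g = b₂))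

theorem DoubleThreat.reply {U : Set W} {Φ : W → Set ℕ} {v : ℕ → W} {n c₁ c₂ b₁ b₂ : ℕ}
    (h : DoubleThreat H U Φ v n c₁ c₂ b₁ b₂) (hn : 1 ≤ n) {i g : ℕ} (hi : i ≤ n) (hg : g < 4)
    (hgi : g ∉ Φ (v i)) :
    ∃ v' c₁' c₂' x' n', n' < n ∧
      Threat H (U \ {v i}) (spread H Φ (v i) g) v' n' c₁' c₂' x' := by
  have hne := h.ne
  have hne' := h.ne'
  have hp := h.parity g hg
  have h0 : i = 0 → ¬ (g = c₁ ∨ g = c₂) := by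
    rintro rfl (rfl | rfl)
    exacts [hgi h.mem₁, hgi h.mem₂]
  have hlast : i = n → ¬ (g = b₁ ∨ g = b₂) := by
    rintro rfl (rfl | rfl)
    exacts [hgi h.mem₁', hgi h.mem₂']
  by_cases hl : 1 ≤ i ∧ ((i - 1) % 2 = 1 ↔ (g = c₁ ∨ g = c₂))
  · refine ⟨v, c₁, c₂, g, i - 1, by omega, ?_⟩
    refine { h.toIsRoute.before hi hl.1 with
      ne := hne, lt₁ := h.lt₁, lt₂ := h.lt₂, ltx := hg, mem₁ := Or.inl h.mem₁,
      mem₂ := Or.inl h.mem₂, memx := Or.inr ⟨?_, rfl⟩, parity := hl.2 }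
    have := h.adj (i - 1) (by omega)
    rw [Nat.sub_add_cancel hl.1] at this
    exact this.symm
  · have hin : i < n := by
      by_contra hin
      have : i = n := by omega
      have := hlast this
      by_cases hc : g = c₁ ∨ g = c₂
      · simp only [hc, this, iff_true, iff_false, not_true_eq_false] at hp hl
        omega
      · simp only [hc, this, iff_self, iff_true, iff_false] at hp hl
        omega
    have hr := h.toIsRoute.reverse.before (i := n - i) (by omega) (by omega)
    have e : n - (n - i) = i := by omega
    simp only [e] at hr
    refine ⟨fun j => v (n - j), b₁, b₂, g, n - i - 1, by omega, ?_⟩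
    refine { hr with
      ne := hne', lt₁ := h.lt₁', lt₂ := h.lt₂', ltx := hg, mem₁ := Or.inl h.mem₁',
      mem₂ := Or.inl h.mem₂', memx := Or.inr ⟨?_, rfl⟩, parity := ?_ }
    · rw [show n - (n - i - 1) = i + 1 by omega]
      exact h.adj i hin
    · by_cases hi0 : i = 0
      · have := h0 hi0
        by_cases hb : g = b₁ ∨ g = b₂
        · simp only [hb, this, iff_true, iff_false] at hp ⊢
          omega
        · simp only [hb, this, iff_self, iff_true, iff_false] at hp ⊢
          omega
      · by_cases hc : g = c₁ ∨ g = c₂ <;> by_cases hb : g = b₁ ∨ g = b₂ <;>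
          simp only [hb, hc, iff_self, iff_true, iff_false, not_true_eq_false] at hp hl ⊢ <;> omega

theorem exists_fourth (a b c : ℕ) : ∃ d < 4, d ≠ a ∧ d ≠ b ∧ d ≠ c := by
  by_contra! h
  have h0 := h 0
  have h1 := h 1
  have h2 := h 2
  have h3 := h 3
  omega

theorem Threat.bobForces : ∀ (n : ℕ) {U : Set W} {Φ : W → Set ℕ} {v : ℕ → W} {c₁ c₂ x : ℕ},
    Threat H U Φ v n c₁ c₂ x → BobForces 4 H (2 * n + 1) U Φ := by
  intro n
  induction n using Nat.strong_induction_on with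
  | _ n ih =>
  intro U Φ v c₁ c₂ x h
  obtain ⟨d, hd4, hd1, hd2, hdx⟩ := exists_fourth c₁ c₂ x
  have hpar := h.parity
  have hne := h.ne
  have l1 := h.lt₁
  have l2 := h.lt₂
  have lx := h.ltx
  rcases Nat.eq_zero_or_pos n with rfl | hn
  · refine .of_one_left (h.mem 0 le_rfl) hd4 (fun a ha => ?_) _
    have h1 := h.mem₁
    have h2 := h.mem₂
    have h3 := h.memx
    have : a = c₁ ∨ a = c₂ ∨ a = x ∨ a = d := by omega
    rcases this with rfl | rfl | rfl | rfl <;> simp_all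
  have hb : ∃ b < 4, b ≠ x ∧
      ∀ g < 4, n % 2 = 1 ↔ ((g = c₁ ∨ g = c₂) ↔ (g = x ∨ g = b)) := by
    by_cases hx : x = c₁ ∨ x = c₂
    · have hp := hpar.2 hx
      rcases hx with rfl | rfl
      · exact ⟨c₂, l2, hne.symm, fun g _ => by simp [hp]⟩
      · exact ⟨c₁, l1, hne, fun g _ => by simp [hp, or_comm]⟩
    · have hp := mt hpar.1 hx
      refine ⟨d, hd4, hdx, fun g hg => ?_⟩
      simp only [hp, false_iff]
      omega
  obtain ⟨b, hb4, hbx, hbp⟩ := hb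
  set Φ₁ := addColor Φ (v n) b with hΦ₁
  have hDT : DoubleThreat H U Φ₁ v n c₁ c₂ x b :=
    { h.toIsRoute with
      ne := hne, lt₁ := l1, lt₂ := l2, ne' := hbx.symm, lt₁' := lx, lt₂' := hb4,
      mem₁ := Or.inl h.mem₁, mem₂ := Or.inl h.mem₂, mem₁' := Or.inl h.memx,
      mem₂' := Or.inr ⟨rfl, rfl⟩, parity := hbp }
  obtain ⟨m, rfl⟩ : ∃ m, n = m + 1 := ⟨n - 1, by omega⟩
  have hpass : ∀ U' Φ', DoubleThreat H U' Φ' v (m + 1) c₁ c₂ x b →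
      BobForces 4 H (2 * m + 1 + 1) U' Φ' := by
    intro U' Φ' hD
    obtain ⟨f, hf4, hf1, hf2, hfd⟩ := exists_fourth c₁ c₂ d
    have hv0 := hD.mem 0 (Nat.zero_le _)
    have key : ∀ a < 4, a ∈ addColor Φ' (v 0) d (v 0) ∨ a = f := by
      intro a ha
      have : a = c₁ ∨ a = c₂ ∨ a = d ∨ a = f := by omega
      rcases this with rfl | rfl | rfl | rfl
      · exact Or.inl (Or.inl hD.mem₁)
      · exact Or.inl (Or.inl hD.mem₂)
      · exact Or.inl (Or.inr ⟨rfl, rfl⟩)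
      · exact Or.inr rfl
    have hD₂ : DoubleThreat H U' (addColor Φ' (v 0) d) v (m + 1) c₁ c₂ x b :=
      { hD with
        mem₁ := Or.inl hD.mem₁, mem₂ := Or.inl hD.mem₂, mem₁' := Or.inl hD.mem₁',
        mem₂' := Or.inl hD.mem₂' }
    refine Or.inr ⟨v 0, hv0, d, hd4, .of_one_left hv0 hf4 key _, fun w hw g hg hgw => ?_⟩
    by_cases hw0 : w = v 0
    · subst hw0
      obtain ⟨v', c₁', c₂', x', n', hlt, hT⟩ := hD₂.reply hn (Nat.zero_le _) hg hgw
      exact (ih n' hlt hT).of_le (by omega)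
    · have hv0w : v 0 ∈ U' \ {w} := ⟨hv0, fun h' => hw0 h'.symm⟩
      exact .of_one_left hv0w hf4 (fun a ha => (key a ha).imp Or.inl id) _
  have hE : DoubleThreat H U (addColor Φ (v (m + 1)) b) v (m + 1) c₁ c₂ x b :=
    { h.toIsRoute with
      ne := hne, lt₁ := l1, lt₂ := l2, ne' := hbx.symm, lt₁' := lx, lt₂' := hb4,
      mem₁ := Or.inl h.mem₁, mem₂ := Or.inl h.mem₂, mem₁' := Or.inl h.memx,
      mem₂' := Or.inr ⟨rfl, rfl⟩, parity := hbp }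
  refine Or.inr ⟨v (m + 1), h.mem _ le_rfl, b, hb4, hpass _ _ hE, fun w hw g hg hgw => ?_⟩
  by_cases hwv : ∃ i ≤ m + 1, w = v i
  · obtain ⟨i, hi, rfl⟩ := hwv
    obtain ⟨v', c₁', c₂', x', n', hlt, hT⟩ := hE.reply hn hi hg hgw
    exact (ih n' hlt hT).of_le (by omega)
  · push Not at hwv
    exact hpass _ _
      { hE with
        mem := fun i hi => ⟨h.mem i hi, fun h' => hwv i hi h'.symm⟩,
        mem₁ := Or.inl hE.mem₁, mem₂ := Or.inl hE.mem₂, mem₁' := Or.inl hE.mem₁',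
        mem₂' := Or.inl hE.mem₂' }

end

/-- What is known at a named vertex of a pattern beyond its named neighbours: nothing, routes of
both parities to a common forbidden colour, or one route of given parity to a forbidden colour. -/
inductive Tail : Type
  | none : Tail
  | both : Tail
  | exact (odd : Bool) (x : ℕ) : Tail

/-- An abstract position of the core game. The vertices are named `0, …, 7`; `al` says which are
uncoloured, `ph` which colours are forbidden at them, `tl` describes the tails, and `lk` says
whether the vertices `0` and `1` are linked by a route with an odd number of interior vertices.
The constituents of a pattern are numbered: `i` is the vertex `i`, `8 + i` is the tail of the
vertex `i`, and `16` is the link. -/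
structure Pattern : Type where
  al : ℕ → Bool
  ph : ℕ → ℕ → Bool
  tl : ℕ → Tail
  lk : Bool

/-- Adjacency of the named vertices. -/
def namedAdj (i j : ℕ) : Bool :=
  (i == 0 && j == 1) || (i == 1 && j == 0) || (decide (i < 2) && j == i + 2) ||
    (decide (j < 2) && i == j + 2) || (decide (i < 4) && j == i + 4) ||
    (decide (j < 4) && i == j + 4)

namespace Pattern

/-- Forbid the colour `a` at `v`. -/
def forbid (P : Pattern) (v a : ℕ) : Pattern :=
  { P with ph := fun j c => P.ph j c || (j == v && c == a) }

/-- Delete the constituent `e`. -/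
def del (P : Pattern) (e : ℕ) : Pattern where
  al i := P.al i && i != e
  ph := P.ph
  tl i := bif i + 8 == e then .none else P.tl i
  lk := P.lk && e != 16

/-- Keep only the constituents in `K`. -/
def restrict (P : Pattern) (K : List ℕ) : Pattern where
  al i := P.al i && K.elem i
  ph := P.ph
  tl i := bif K.elem (i + 8) then P.tl i else .none
  lk := P.lk && K.elem 16

/-- Colour the vertex `i` with `g`. -/
def paint (P : Pattern) (i g : ℕ) : Pattern where
  al j := P.al j && j != i
  ph j c := P.ph j c || (namedAdj i j && c == g)
  tl j := bif P.lk && ((i == 0 && j == 1) || (i == 1 && j == 0)) then .exact true g else P.tl j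
  lk := P.lk && i != 0 && i != 1

/-- The list is a path of uncoloured named vertices. -/
def isPath (P : Pattern) : List ℕ → Bool
  | [] => false
  | v :: r => P.al v && !r.elem v &&
      match r with
      | [] => true
      | w :: _ => namedAdj v w && P.isPath r

/-- The colours `c₁`, `c₂` forbidden at the head of `p` form a threat with the colour `e`
forbidden at the last vertex of `p` or, if `e = 4`, with the tail of that vertex. -/
def isThreat (P : Pattern) (c₁ c₂ : ℕ) (p : List ℕ) (e : ℕ) : Bool :=
  c₁ != c₂ && decide (c₁ < 4) && decide (c₂ < 4) && P.isPath p &&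
    P.ph (p.headD 0) c₁ && P.ph (p.headD 0) c₂ &&
    bif decide (e < 4) then
      P.ph (p.getLastD 0) e && ((p.length % 2 == 0) == (e == c₁ || e == c₂))
    else
      match P.tl (p.getLastD 0) with
      | .none => false
      | .both => true
      | .exact o x => (((p.length + bif o then 1 else 0) % 2 == 0) == (x == c₁ || x == c₂))

end Pattern

/-- Strategies of Bob in patterns. A strategy is a threat `leaf`, or a move `node v a C R`
followed by `C` if Alice does not touch a constituent dealt with by the list of responses `R`.
A list of responses is built by `nil`, `del` (delete the constituent touched by Alice and
continue) and `col` (one continuation for each colour of the vertex coloured by Alice). -/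
inductive Cert : Type
  | leaf (c₁ c₂ : ℕ) (p : List ℕ) (e : ℕ) : Cert
  | node (v a : ℕ) (C R : Cert) : Cert
  | nil : Cert
  | del (e : ℕ) (C R : Cert) : Cert
  | col (i : ℕ) (C₀ C₁ C₂ C₃ R : Cert) : Cert

namespace Cert

/-- The constituents dealt with by a list of responses. -/
def keys : Cert → List ℕ
  | del e _ R => e :: keys R
  | col i _ _ _ _ R => i :: keys R
  | _ => []

/-- A bound for the number of moves before a threat is reached. -/
def depth : Cert → ℕ
  | leaf _ _ _ _ => 0
  | node _ _ C R => max C.depth R.depth + 1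
  | nil => 0
  | del _ C R => max C.depth R.depth
  | col _ C₀ C₁ C₂ C₃ R =>
      max (max (max C₀.depth C₁.depth) (max C₂.depth C₃.depth)) R.depth

/-- Verify a strategy (`b = false`) or a list of responses (`b = true`) in a pattern. -/
def check : Cert → Bool → Pattern → Bool
  | leaf c₁ c₂ p e, b, P => !b && P.isThreat c₁ c₂ p e
  | node v a C R, b, P => !b && P.al v && decide (a < 4) &&
      C.check false ((P.forbid v a).restrict R.keys) && R.check true (P.forbid v a)
  | nil, b, _ => b
  | del e C R, b, P => b && C.check false (P.del e) && R.check true P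
  | col i C₀ C₁ C₂ C₃ R, b, P => b && P.al i &&
      (P.ph i 0 || C₀.check false (P.paint i 0)) && (P.ph i 1 || C₁.check false (P.paint i 1)) &&
      (P.ph i 2 || C₂.check false (P.paint i 2)) && (P.ph i 3 || C₃.check false (P.paint i 3)) &&
      R.check true P

end Cert

/-- The initial pattern: nothing is forbidden, the vertices `0` and `1` are linked, and the
vertices `2` and `3` have tails of both parities. -/
def startPattern : Pattern where
  al i := decide (i < 8)
  ph _ _ := false
  tl i := bif i == 2 || i == 3 then .both else .none
  lk := true

/-- A winning strategy of Bob in the initial pattern. -/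
def startCert : Cert :=
    (.node 0 0 (.node 1 0 (.node 0 1 (.leaf 0 1 [0, 1] 0) (.col 0 .nil .nil (.leaf 0 2 [1] 4)
    (.leaf 0 3 [1] 4) (.del 1 (.leaf 0 1 [0, 2] 4) .nil))) (.col 0 .nil (.leaf 0 1 [1] 4) (.leaf 0
    2 [1] 4) (.leaf 0 3 [1] 4) (.col 1 .nil (.leaf 0 1 [0] 4) (.leaf 0 2 [0] 4) (.leaf 0 3 [0] 4)
    (.del 2 (.node 1 1 (.leaf 0 1 [1, 0] 0) (.del 0 (.leaf 0 1 [1, 3] 4) (.col 1 .nil .nil (.leaf 0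
    2 [0] 4) (.leaf 0 3 [0] 4) .nil))) (.del 10 (.node 1 1 (.leaf 0 1 [1, 0] 0) (.del 0 (.leaf 0 1
    [1, 3] 4) (.col 1 .nil .nil (.leaf 0 2 [0] 4) (.leaf 0 3 [0] 4) .nil))) (.del 16 (.node 0 1
    (.leaf 0 1 [0, 1] 0) (.col 0 .nil .nil (.leaf 0 2 [1, 3] 4) (.leaf 0 3 [1, 3] 4) (.del 1 (.leaf
    0 1 [0, 2] 4) .nil))) .nil)))))) (.col 0 .nil (.node 3 1 (.node 1 0 (.leaf 0 1 [1] 4) (.col 1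
    .nil .nil (.leaf 1 2 [3] 4) (.leaf 1 3 [3] 4) (.del 9 (.leaf 0 1 [1, 3] 1) .nil))) (.col 1
    (.leaf 0 1 [3] 4) .nil (.leaf 1 2 [3] 4) (.leaf 1 3 [3] 4) (.col 3 (.leaf 0 1 [1] 4) .nil
    (.leaf 1 2 [1] 4) (.leaf 1 3 [1] 4) (.del 9 (.node 5 1 (.node 1 0 (.leaf 0 1 [1, 3] 1) (.col 1
    .nil .nil (.leaf 1 2 [3] 4) (.leaf 1 3 [3] 4) (.del 3 (.leaf 0 1 [1, 5] 1) .nil))) (.col 1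
    (.leaf 0 1 [3] 4) .nil (.leaf 1 2 [3] 4) (.leaf 1 3 [3] 4) (.col 3 (.leaf 0 1 [1, 5] 1) .nil
    (.leaf 1 2 [1, 5] 1) (.leaf 1 3 [1, 5] 1) (.col 5 (.leaf 0 1 [1, 3] 1) .nil (.leaf 1 2 [1, 3]
    1) (.leaf 1 3 [1, 3] 1) (.del 11 (.node 7 1 (.node 1 0 (.leaf 0 1 [1, 3] 1) (.col 1 .nil .nil
    (.leaf 1 2 [3, 7] 1) (.leaf 1 3 [3, 7] 1) (.del 3 (.leaf 0 1 [1, 5] 1) .nil))) (.col 1 (.leaf 0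
    1 [3, 7] 1) .nil (.leaf 1 2 [3, 7] 1) (.leaf 1 3 [3, 7] 1) (.col 3 (.leaf 0 1 [1, 5] 1) .nil
    (.leaf 1 2 [1, 5] 1) (.leaf 1 3 [1, 5] 1) (.col 5 (.leaf 0 1 [1, 3] 1) .nil (.leaf 1 2 [1, 3]
    1) (.leaf 1 3 [1, 3] 1) (.col 7 (.leaf 0 1 [3, 1] 1) .nil (.leaf 1 2 [3, 1] 1) (.leaf 1 3 [3,
    1] 1) .nil))))) .nil))))) (.del 11 (.node 7 1 (.node 1 0 (.leaf 0 1 [1] 4) (.col 1 .nil .nil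
    (.leaf 1 2 [3, 7] 1) (.leaf 1 3 [3, 7] 1) (.del 9 (.leaf 0 1 [1, 3] 1) .nil))) (.col 1 (.leaf 0
    1 [3, 7] 1) .nil (.leaf 1 2 [3, 7] 1) (.leaf 1 3 [3, 7] 1) (.col 3 (.leaf 0 1 [1] 4) .nil
    (.leaf 1 2 [1] 4) (.leaf 1 3 [1] 4) (.col 7 (.leaf 0 1 [3, 1] 1) .nil (.leaf 1 2 [3, 1] 1)
    (.leaf 1 3 [3, 1] 1) (.del 9 (.node 5 1 (.node 1 0 (.leaf 0 1 [1, 3] 1) (.col 1 .nil .nil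
    (.leaf 1 2 [3, 7] 1) (.leaf 1 3 [3, 7] 1) (.del 3 (.leaf 0 1 [1, 5] 1) .nil))) (.col 1 (.leaf 0
    1 [3, 7] 1) .nil (.leaf 1 2 [3, 7] 1) (.leaf 1 3 [3, 7] 1) (.col 3 (.leaf 0 1 [1, 5] 1) .nil
    (.leaf 1 2 [1, 5] 1) (.leaf 1 3 [1, 5] 1) (.col 5 (.leaf 0 1 [1, 3] 1) .nil (.leaf 1 2 [1, 3]
    1) (.leaf 1 3 [1, 3] 1) (.col 7 (.leaf 0 1 [3, 1] 1) .nil (.leaf 1 2 [3, 1] 1) (.leaf 1 3 [3,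
    1] 1) .nil))))) .nil))))) .nil))))) (.node 3 2 (.node 1 0 (.leaf 0 2 [1] 4) (.col 1 .nil (.leaf
    1 2 [3] 4) .nil (.leaf 2 3 [3] 4) (.del 9 (.leaf 0 2 [1, 3] 2) .nil))) (.col 1 (.leaf 0 2 [3]
    4) (.leaf 1 2 [3] 4) .nil (.leaf 2 3 [3] 4) (.col 3 (.leaf 0 2 [1] 4) (.leaf 1 2 [1] 4) .nil
    (.leaf 2 3 [1] 4) (.del 9 (.node 5 2 (.node 1 0 (.leaf 0 2 [1, 3] 2) (.col 1 .nil (.leaf 1 2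
    [3] 4) .nil (.leaf 2 3 [3] 4) (.del 3 (.leaf 0 2 [1, 5] 2) .nil))) (.col 1 (.leaf 0 2 [3] 4)
    (.leaf 1 2 [3] 4) .nil (.leaf 2 3 [3] 4) (.col 3 (.leaf 0 2 [1, 5] 2) (.leaf 1 2 [1, 5] 2) .nil
    (.leaf 2 3 [1, 5] 2) (.col 5 (.leaf 0 2 [1, 3] 2) (.leaf 1 2 [1, 3] 2) .nil (.leaf 2 3 [1, 3]
    2) (.del 11 (.node 7 2 (.node 1 0 (.leaf 0 2 [1, 3] 2) (.col 1 .nil (.leaf 1 2 [3, 7] 2) .nil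
    (.leaf 2 3 [3, 7] 2) (.del 3 (.leaf 0 2 [1, 5] 2) .nil))) (.col 1 (.leaf 0 2 [3, 7] 2) (.leaf 1
    2 [3, 7] 2) .nil (.leaf 2 3 [3, 7] 2) (.col 3 (.leaf 0 2 [1, 5] 2) (.leaf 1 2 [1, 5] 2) .nil
    (.leaf 2 3 [1, 5] 2) (.col 5 (.leaf 0 2 [1, 3] 2) (.leaf 1 2 [1, 3] 2) .nil (.leaf 2 3 [1, 3]
    2) (.col 7 (.leaf 0 2 [3, 1] 2) (.leaf 1 2 [3, 1] 2) .nil (.leaf 2 3 [3, 1] 2) .nil)))))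
    .nil))))) (.del 11 (.node 7 2 (.node 1 0 (.leaf 0 2 [1] 4) (.col 1 .nil (.leaf 1 2 [3, 7] 2)
    .nil (.leaf 2 3 [3, 7] 2) (.del 9 (.leaf 0 2 [1, 3] 2) .nil))) (.col 1 (.leaf 0 2 [3, 7] 2)
    (.leaf 1 2 [3, 7] 2) .nil (.leaf 2 3 [3, 7] 2) (.col 3 (.leaf 0 2 [1] 4) (.leaf 1 2 [1] 4) .nil
    (.leaf 2 3 [1] 4) (.col 7 (.leaf 0 2 [3, 1] 2) (.leaf 1 2 [3, 1] 2) .nil (.leaf 2 3 [3, 1] 2)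
    (.del 9 (.node 5 2 (.node 1 0 (.leaf 0 2 [1, 3] 2) (.col 1 .nil (.leaf 1 2 [3, 7] 2) .nil
    (.leaf 2 3 [3, 7] 2) (.del 3 (.leaf 0 2 [1, 5] 2) .nil))) (.col 1 (.leaf 0 2 [3, 7] 2) (.leaf 1
    2 [3, 7] 2) .nil (.leaf 2 3 [3, 7] 2) (.col 3 (.leaf 0 2 [1, 5] 2) (.leaf 1 2 [1, 5] 2) .nil
    (.leaf 2 3 [1, 5] 2) (.col 5 (.leaf 0 2 [1, 3] 2) (.leaf 1 2 [1, 3] 2) .nil (.leaf 2 3 [1, 3]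
    2) (.col 7 (.leaf 0 2 [3, 1] 2) (.leaf 1 2 [3, 1] 2) .nil (.leaf 2 3 [3, 1] 2) .nil)))))
    .nil))))) .nil))))) (.node 3 3 (.node 1 0 (.leaf 0 3 [1] 4) (.col 1 .nil (.leaf 1 3 [3] 4)
    (.leaf 2 3 [3] 4) .nil (.del 9 (.leaf 0 3 [1, 3] 3) .nil))) (.col 1 (.leaf 0 3 [3] 4) (.leaf 1
    3 [3] 4) (.leaf 2 3 [3] 4) .nil (.col 3 (.leaf 0 3 [1] 4) (.leaf 1 3 [1] 4) (.leaf 2 3 [1] 4)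
    .nil (.del 9 (.node 5 3 (.node 1 0 (.leaf 0 3 [1, 3] 3) (.col 1 .nil (.leaf 1 3 [3] 4) (.leaf 2
    3 [3] 4) .nil (.del 3 (.leaf 0 3 [1, 5] 3) .nil))) (.col 1 (.leaf 0 3 [3] 4) (.leaf 1 3 [3] 4)
    (.leaf 2 3 [3] 4) .nil (.col 3 (.leaf 0 3 [1, 5] 3) (.leaf 1 3 [1, 5] 3) (.leaf 2 3 [1, 5] 3)
    .nil (.col 5 (.leaf 0 3 [1, 3] 3) (.leaf 1 3 [1, 3] 3) (.leaf 2 3 [1, 3] 3) .nil (.del 11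
    (.node 7 3 (.node 1 0 (.leaf 0 3 [1, 3] 3) (.col 1 .nil (.leaf 1 3 [3, 7] 3) (.leaf 2 3 [3, 7]
    3) .nil (.del 3 (.leaf 0 3 [1, 5] 3) .nil))) (.col 1 (.leaf 0 3 [3, 7] 3) (.leaf 1 3 [3, 7] 3)
    (.leaf 2 3 [3, 7] 3) .nil (.col 3 (.leaf 0 3 [1, 5] 3) (.leaf 1 3 [1, 5] 3) (.leaf 2 3 [1, 5]
    3) .nil (.col 5 (.leaf 0 3 [1, 3] 3) (.leaf 1 3 [1, 3] 3) (.leaf 2 3 [1, 3] 3) .nil (.col 7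
    (.leaf 0 3 [3, 1] 3) (.leaf 1 3 [3, 1] 3) (.leaf 2 3 [3, 1] 3) .nil .nil))))) .nil))))) (.del
    11 (.node 7 3 (.node 1 0 (.leaf 0 3 [1] 4) (.col 1 .nil (.leaf 1 3 [3, 7] 3) (.leaf 2 3 [3, 7]
    3) .nil (.del 9 (.leaf 0 3 [1, 3] 3) .nil))) (.col 1 (.leaf 0 3 [3, 7] 3) (.leaf 1 3 [3, 7] 3)
    (.leaf 2 3 [3, 7] 3) .nil (.col 3 (.leaf 0 3 [1] 4) (.leaf 1 3 [1] 4) (.leaf 2 3 [1] 4) .nil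
    (.col 7 (.leaf 0 3 [3, 1] 3) (.leaf 1 3 [3, 1] 3) (.leaf 2 3 [3, 1] 3) .nil (.del 9 (.node 5 3
    (.node 1 0 (.leaf 0 3 [1, 3] 3) (.col 1 .nil (.leaf 1 3 [3, 7] 3) (.leaf 2 3 [3, 7] 3) .nil
    (.del 3 (.leaf 0 3 [1, 5] 3) .nil))) (.col 1 (.leaf 0 3 [3, 7] 3) (.leaf 1 3 [3, 7] 3) (.leaf 2
    3 [3, 7] 3) .nil (.col 3 (.leaf 0 3 [1, 5] 3) (.leaf 1 3 [1, 5] 3) (.leaf 2 3 [1, 5] 3) .nil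
    (.col 5 (.leaf 0 3 [1, 3] 3) (.leaf 1 3 [1, 3] 3) (.leaf 2 3 [1, 3] 3) .nil (.col 7 (.leaf 0 3
    [3, 1] 3) (.leaf 1 3 [3, 1] 3) (.leaf 2 3 [3, 1] 3) .nil .nil))))) .nil))))) .nil))))) (.col 1
    (.node 2 0 (.node 0 1 (.leaf 0 1 [0] 4) (.col 0 .nil .nil (.leaf 0 2 [2] 4) (.leaf 0 3 [2] 4)
    (.del 8 (.leaf 0 1 [0, 2] 0) .nil))) (.col 0 .nil (.leaf 0 1 [2] 4) (.leaf 0 2 [2] 4) (.leaf 0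
    3 [2] 4) (.col 2 .nil (.leaf 0 1 [0] 4) (.leaf 0 2 [0] 4) (.leaf 0 3 [0] 4) (.del 8 (.node 4 0
    (.node 0 1 (.leaf 0 1 [0, 2] 0) (.col 0 .nil .nil (.leaf 0 2 [2] 4) (.leaf 0 3 [2] 4) (.del 2
    (.leaf 0 1 [0, 4] 0) .nil))) (.col 0 .nil (.leaf 0 1 [2] 4) (.leaf 0 2 [2] 4) (.leaf 0 3 [2] 4)
    (.col 2 .nil (.leaf 0 1 [0, 4] 0) (.leaf 0 2 [0, 4] 0) (.leaf 0 3 [0, 4] 0) (.col 4 .nil (.leaf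
    0 1 [0, 2] 0) (.leaf 0 2 [0, 2] 0) (.leaf 0 3 [0, 2] 0) (.del 10 (.node 6 0 (.node 0 1 (.leaf 0
    1 [0, 2] 0) (.col 0 .nil .nil (.leaf 0 2 [2, 6] 0) (.leaf 0 3 [2, 6] 0) (.del 2 (.leaf 0 1 [0,
    4] 0) .nil))) (.col 0 .nil (.leaf 0 1 [2, 6] 0) (.leaf 0 2 [2, 6] 0) (.leaf 0 3 [2, 6] 0) (.col
    2 .nil (.leaf 0 1 [0, 4] 0) (.leaf 0 2 [0, 4] 0) (.leaf 0 3 [0, 4] 0) (.col 4 .nil (.leaf 0 1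
    [0, 2] 0) (.leaf 0 2 [0, 2] 0) (.leaf 0 3 [0, 2] 0) (.col 6 .nil (.leaf 0 1 [2, 0] 0) (.leaf 0
    2 [2, 0] 0) (.leaf 0 3 [2, 0] 0) .nil))))) .nil))))) (.del 10 (.node 6 0 (.node 0 1 (.leaf 0 1
    [0] 4) (.col 0 .nil .nil (.leaf 0 2 [2, 6] 0) (.leaf 0 3 [2, 6] 0) (.del 8 (.leaf 0 1 [0, 2] 0)
    .nil))) (.col 0 .nil (.leaf 0 1 [2, 6] 0) (.leaf 0 2 [2, 6] 0) (.leaf 0 3 [2, 6] 0) (.col 2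
    .nil (.leaf 0 1 [0] 4) (.leaf 0 2 [0] 4) (.leaf 0 3 [0] 4) (.col 6 .nil (.leaf 0 1 [2, 0] 0)
    (.leaf 0 2 [2, 0] 0) (.leaf 0 3 [2, 0] 0) (.del 8 (.node 4 0 (.node 0 1 (.leaf 0 1 [0, 2] 0)
    (.col 0 .nil .nil (.leaf 0 2 [2, 6] 0) (.leaf 0 3 [2, 6] 0) (.del 2 (.leaf 0 1 [0, 4] 0)
    .nil))) (.col 0 .nil (.leaf 0 1 [2, 6] 0) (.leaf 0 2 [2, 6] 0) (.leaf 0 3 [2, 6] 0) (.col 2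
    .nil (.leaf 0 1 [0, 4] 0) (.leaf 0 2 [0, 4] 0) (.leaf 0 3 [0, 4] 0) (.col 4 .nil (.leaf 0 1 [0,
    2] 0) (.leaf 0 2 [0, 2] 0) (.leaf 0 3 [0, 2] 0) (.col 6 .nil (.leaf 0 1 [2, 0] 0) (.leaf 0 2
    [2, 0] 0) (.leaf 0 3 [2, 0] 0) .nil))))) .nil))))) .nil))))) (.leaf 0 1 [0] 4) (.leaf 0 2 [0]
    4) (.leaf 0 3 [0] 4) (.del 2 (.node 1 0 (.node 1 1 (.leaf 0 1 [1, 0] 0) (.del 0 (.leaf 0 1 [1,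
    3] 4) (.col 1 .nil .nil (.leaf 0 2 [0] 4) (.leaf 0 3 [0] 4) .nil))) (.col 0 .nil (.leaf 0 1 [1]
    4) (.leaf 0 2 [1] 4) (.leaf 0 3 [1] 4) (.col 1 .nil (.leaf 0 1 [0] 4) (.leaf 0 2 [0] 4) (.leaf
    0 3 [0] 4) (.del 3 (.node 0 1 (.leaf 0 1 [0, 1] 0) (.col 0 .nil .nil (.leaf 0 2 [1] 4) (.leaf 0
    3 [1] 4) (.col 1 .nil (.leaf 0 1 [0] 4) (.leaf 0 1 [0] 2) (.leaf 0 1 [0] 3) .nil))) (.del 11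
    (.node 0 1 (.leaf 0 1 [0, 1] 0) (.col 0 .nil .nil (.leaf 0 2 [1] 4) (.leaf 0 3 [1] 4) (.col 1
    .nil (.leaf 0 1 [0] 4) (.leaf 0 1 [0] 2) (.leaf 0 1 [0] 3) .nil))) (.del 16 (.node 3 0 (.node 1
    1 (.leaf 0 1 [1, 0] 0) (.del 0 (.leaf 0 1 [1, 3] 0) (.col 1 .nil .nil (.leaf 0 2 [3] 4) (.leaf
    0 3 [3] 4) .nil))) (.col 0 .nil (.leaf 0 1 [1, 3] 0) (.leaf 0 2 [1, 3] 0) (.leaf 0 3 [1, 3] 0)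
    (.col 1 .nil (.leaf 0 1 [3] 4) (.leaf 0 2 [3] 4) (.leaf 0 3 [3] 4) (.col 3 .nil (.leaf 0 1 [1,
    0] 0) (.leaf 0 2 [1, 0] 0) (.leaf 0 3 [1, 0] 0) (.del 11 (.node 4 0 (.node 0 1 (.leaf 0 1 [0,
    1] 0) (.col 0 .nil .nil (.leaf 0 2 [1, 3] 0) (.leaf 0 3 [1, 3] 0) (.del 1 (.leaf 0 1 [0, 4] 0)
    .nil))) (.col 0 .nil (.leaf 0 1 [1, 3] 0) (.leaf 0 2 [1, 3] 0) (.leaf 0 3 [1, 3] 0) (.col 1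
    .nil (.leaf 0 1 [0, 4] 0) (.leaf 0 2 [0, 4] 0) (.leaf 0 3 [0, 4] 0) (.col 3 .nil (.leaf 0 1 [1,
    0] 0) (.leaf 0 2 [1, 0] 0) (.leaf 0 3 [1, 0] 0) (.col 4 .nil (.leaf 0 1 [0, 1] 0) (.leaf 0 2
    [0, 1] 0) (.leaf 0 3 [0, 1] 0) .nil))))) .nil))))) .nil)))))) (.col 3 (.node 0 1 (.leaf 0 1 [0,
    1] 0) (.col 0 .nil .nil (.leaf 0 2 [1] 4) (.leaf 0 3 [1] 4) (.del 1 (.leaf 0 1 [0, 2] 4)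
    .nil))) (.node 0 1 (.leaf 0 1 [0, 1] 1) (.col 0 .nil .nil (.leaf 1 2 [1] 4) (.leaf 1 3 [1] 4)
    (.del 1 (.leaf 0 1 [0, 2] 4) .nil))) (.node 0 2 (.leaf 0 2 [0, 1] 2) (.col 0 .nil (.leaf 1 2
    [1] 4) .nil (.leaf 2 3 [1] 4) (.del 1 (.leaf 0 2 [0, 2] 4) .nil))) (.node 0 3 (.leaf 0 3 [0, 1]
    3) (.col 0 .nil (.leaf 1 3 [1] 4) (.leaf 2 3 [1] 4) .nil (.del 1 (.leaf 0 3 [0, 2] 4) .nil)))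
    (.del 10 (.node 1 0 (.node 1 1 (.leaf 0 1 [1, 0] 0) (.del 0 (.leaf 0 1 [1, 3] 4) (.col 1 .nil
    .nil (.leaf 0 2 [0] 4) (.leaf 0 3 [0] 4) .nil))) (.col 0 .nil (.leaf 0 1 [1] 4) (.leaf 0 2 [1]
    4) (.leaf 0 3 [1] 4) (.col 1 .nil (.leaf 0 1 [0] 4) (.leaf 0 2 [0] 4) (.leaf 0 3 [0] 4) (.del 3
    (.node 0 1 (.leaf 0 1 [0, 1] 0) (.col 0 .nil .nil (.leaf 0 2 [1] 4) (.leaf 0 3 [1] 4) (.col 1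
    .nil (.leaf 0 1 [0] 4) (.leaf 0 1 [0] 2) (.leaf 0 1 [0] 3) .nil))) (.del 11 (.node 0 1 (.leaf 0
    1 [0, 1] 0) (.col 0 .nil .nil (.leaf 0 2 [1] 4) (.leaf 0 3 [1] 4) (.col 1 .nil (.leaf 0 1 [0]
    4) (.leaf 0 1 [0] 2) (.leaf 0 1 [0] 3) .nil))) (.del 16 (.node 3 0 (.node 1 1 (.leaf 0 1 [1, 0]
    0) (.del 0 (.leaf 0 1 [1, 3] 0) (.col 1 .nil .nil (.leaf 0 2 [3] 4) (.leaf 0 3 [3] 4) .nil)))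
    (.col 0 .nil (.leaf 0 1 [1, 3] 0) (.leaf 0 2 [1, 3] 0) (.leaf 0 3 [1, 3] 0) (.col 1 .nil (.leaf
    0 1 [3] 4) (.leaf 0 2 [3] 4) (.leaf 0 3 [3] 4) (.col 3 .nil (.leaf 0 1 [1, 0] 0) (.leaf 0 2 [1,
    0] 0) (.leaf 0 3 [1, 0] 0) (.del 11 (.node 2 0 (.node 0 1 (.leaf 0 1 [0, 1] 0) (.col 0 .nil
    .nil (.leaf 0 2 [1, 3] 0) (.leaf 0 3 [1, 3] 0) (.del 1 (.leaf 0 1 [0, 2] 0) .nil))) (.col 0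
    .nil (.leaf 0 1 [1, 3] 0) (.leaf 0 2 [1, 3] 0) (.leaf 0 3 [1, 3] 0) (.col 1 .nil (.leaf 0 1 [0,
    2] 0) (.leaf 0 2 [0, 2] 0) (.leaf 0 3 [0, 2] 0) (.col 2 .nil (.leaf 0 1 [0, 1] 0) (.leaf 0 2
    [0, 1] 0) (.leaf 0 3 [0, 1] 0) (.col 3 .nil (.leaf 0 1 [1, 0] 0) (.leaf 0 2 [1, 0] 0) (.leaf 0
    3 [1, 0] 0) .nil))))) .nil))))) .nil)))))) (.del 11 (.node 1 0 (.node 0 1 (.leaf 0 1 [0, 1] 0)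
    (.col 0 .nil .nil (.leaf 0 2 [1] 4) (.leaf 0 3 [1] 4) (.del 1 (.leaf 0 1 [0, 2] 4) .nil)))
    (.col 0 .nil (.leaf 0 1 [1] 4) (.leaf 0 2 [1] 4) (.leaf 0 3 [1] 4) (.col 1 .nil (.leaf 0 1 [0]
    4) (.leaf 0 2 [0] 4) (.leaf 0 3 [0] 4) (.del 2 (.node 0 1 (.leaf 0 1 [0, 1] 0) (.col 0 .nil
    .nil (.leaf 0 2 [1] 4) (.leaf 0 3 [1] 4) (.col 1 .nil (.leaf 0 1 [0] 4) (.leaf 0 1 [0] 2)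
    (.leaf 0 1 [0] 3) .nil))) (.del 10 (.node 0 1 (.leaf 0 1 [0, 1] 0) (.col 0 .nil .nil (.leaf 0 2
    [1] 4) (.leaf 0 3 [1] 4) (.col 1 .nil (.leaf 0 1 [0] 4) (.leaf 0 1 [0] 2) (.leaf 0 1 [0] 3)
    .nil))) (.del 16 (.node 2 0 (.node 0 1 (.leaf 0 1 [0, 1] 0) (.col 0 .nil .nil (.leaf 0 2 [2] 4)
    (.leaf 0 3 [2] 4) (.del 1 (.leaf 0 1 [0, 2] 0) .nil))) (.col 0 .nil (.leaf 0 1 [2] 4) (.leaf 0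
    2 [2] 4) (.leaf 0 3 [2] 4) (.col 1 .nil (.leaf 0 1 [0, 2] 0) (.leaf 0 2 [0, 2] 0) (.leaf 0 3
    [0, 2] 0) (.col 2 .nil (.leaf 0 1 [0, 1] 0) (.leaf 0 2 [0, 1] 0) (.leaf 0 3 [0, 1] 0) (.del 10
    (.node 3 0 (.node 0 1 (.leaf 0 1 [0, 1] 0) (.col 0 .nil .nil (.leaf 0 2 [1, 3] 0) (.leaf 0 3
    [1, 3] 0) (.del 1 (.leaf 0 1 [0, 2] 0) .nil))) (.col 0 .nil (.leaf 0 1 [1, 3] 0) (.leaf 0 2 [1,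
    3] 0) (.leaf 0 3 [1, 3] 0) (.col 1 .nil (.leaf 0 1 [0, 2] 0) (.leaf 0 2 [0, 2] 0) (.leaf 0 3
    [0, 2] 0) (.col 2 .nil (.leaf 0 1 [0, 1] 0) (.leaf 0 2 [0, 1] 0) (.leaf 0 3 [0, 1] 0) (.col 3
    .nil (.leaf 0 1 [1, 0] 0) (.leaf 0 2 [1, 0] 0) (.leaf 0 3 [1, 0] 0) .nil))))) .nil)))))
    .nil)))))) (.del 16 (.node 1 0 (.node 0 1 (.leaf 0 1 [0, 1] 0) (.col 0 .nil .nil (.leaf 0 2 [1,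
    3] 4) (.leaf 0 3 [1, 3] 4) (.del 1 (.leaf 0 1 [0, 2] 4) .nil))) (.col 0 .nil (.leaf 0 1 [1, 3]
    4) (.leaf 0 2 [1, 3] 4) (.leaf 0 3 [1, 3] 4) (.col 1 .nil (.leaf 0 1 [0, 2] 4) (.leaf 0 2 [0,
    2] 4) (.leaf 0 3 [0, 2] 4) (.del 2 (.node 3 0 (.node 1 1 (.leaf 0 1 [1, 0] 0) (.del 0 (.leaf 0
    1 [1, 3] 0) (.col 1 .nil .nil (.leaf 0 2 [3] 4) (.leaf 0 3 [3] 4) .nil))) (.col 0 .nil (.leaf 0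
    1 [1, 3] 0) (.leaf 0 2 [1, 3] 0) (.leaf 0 3 [1, 3] 0) (.col 1 .nil (.leaf 0 1 [3] 4) (.leaf 0 2
    [3] 4) (.leaf 0 3 [3] 4) (.col 3 .nil (.leaf 0 1 [1, 0] 0) (.leaf 0 2 [1, 0] 0) (.leaf 0 3 [1,
    0] 0) (.del 11 (.node 4 0 (.node 0 1 (.leaf 0 1 [0, 1] 0) (.col 0 .nil .nil (.leaf 0 2 [1, 3]
    0) (.leaf 0 3 [1, 3] 0) (.del 1 (.leaf 0 1 [0, 4] 0) .nil))) (.col 0 .nil (.leaf 0 1 [1, 3] 0)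
    (.leaf 0 2 [1, 3] 0) (.leaf 0 3 [1, 3] 0) (.col 1 .nil (.leaf 0 1 [0, 4] 0) (.leaf 0 2 [0, 4]
    0) (.leaf 0 3 [0, 4] 0) (.col 3 .nil (.leaf 0 1 [1, 0] 0) (.leaf 0 2 [1, 0] 0) (.leaf 0 3 [1,
    0] 0) (.col 4 .nil (.leaf 0 1 [0, 1] 0) (.leaf 0 2 [0, 1] 0) (.leaf 0 3 [0, 1] 0) .nil)))))
    .nil))))) (.del 3 (.node 2 0 (.node 0 1 (.leaf 0 1 [0, 1] 0) (.col 0 .nil .nil (.leaf 0 2 [2]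
    4) (.leaf 0 3 [2] 4) (.del 1 (.leaf 0 1 [0, 2] 0) .nil))) (.col 0 .nil (.leaf 0 1 [2] 4) (.leaf
    0 2 [2] 4) (.leaf 0 3 [2] 4) (.col 1 .nil (.leaf 0 1 [0, 2] 0) (.leaf 0 2 [0, 2] 0) (.leaf 0 3
    [0, 2] 0) (.col 2 .nil (.leaf 0 1 [0, 1] 0) (.leaf 0 2 [0, 1] 0) (.leaf 0 3 [0, 1] 0) (.del 10
    (.node 5 0 (.node 0 1 (.leaf 0 1 [0, 1] 0) (.col 0 .nil .nil (.leaf 0 2 [1, 5] 0) (.leaf 0 3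
    [1, 5] 0) (.del 1 (.leaf 0 1 [0, 2] 0) .nil))) (.col 0 .nil (.leaf 0 1 [1, 5] 0) (.leaf 0 2 [1,
    5] 0) (.leaf 0 3 [1, 5] 0) (.col 1 .nil (.leaf 0 1 [0, 2] 0) (.leaf 0 2 [0, 2] 0) (.leaf 0 3
    [0, 2] 0) (.col 2 .nil (.leaf 0 1 [0, 1] 0) (.leaf 0 2 [0, 1] 0) (.leaf 0 3 [0, 1] 0) (.col 5
    .nil (.leaf 0 1 [1, 0] 0) (.leaf 0 2 [1, 0] 0) (.leaf 0 3 [1, 0] 0) .nil))))) .nil))))) (.del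
    10 (.node 3 0 (.node 1 1 (.leaf 0 1 [1, 0] 0) (.del 0 (.leaf 0 1 [1, 3] 0) (.col 1 .nil .nil
    (.leaf 0 2 [3] 4) (.leaf 0 3 [3] 4) .nil))) (.col 0 .nil (.leaf 0 1 [1, 3] 0) (.leaf 0 2 [1, 3]
    0) (.leaf 0 3 [1, 3] 0) (.col 1 .nil (.leaf 0 1 [3] 4) (.leaf 0 2 [3] 4) (.leaf 0 3 [3] 4)
    (.col 3 .nil (.leaf 0 1 [1, 0] 0) (.leaf 0 2 [1, 0] 0) (.leaf 0 3 [1, 0] 0) (.del 11 (.node 2 0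
    (.node 0 1 (.leaf 0 1 [0, 1] 0) (.col 0 .nil .nil (.leaf 0 2 [1, 3] 0) (.leaf 0 3 [1, 3] 0)
    (.del 1 (.leaf 0 1 [0, 2] 0) .nil))) (.col 0 .nil (.leaf 0 1 [1, 3] 0) (.leaf 0 2 [1, 3] 0)
    (.leaf 0 3 [1, 3] 0) (.col 1 .nil (.leaf 0 1 [0, 2] 0) (.leaf 0 2 [0, 2] 0) (.leaf 0 3 [0, 2]
    0) (.col 2 .nil (.leaf 0 1 [0, 1] 0) (.leaf 0 2 [0, 1] 0) (.leaf 0 3 [0, 1] 0) (.col 3 .nil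
    (.leaf 0 1 [1, 0] 0) (.leaf 0 2 [1, 0] 0) (.leaf 0 3 [1, 0] 0) .nil))))) .nil))))) (.del 11
    (.node 2 0 (.node 0 1 (.leaf 0 1 [0, 1] 0) (.col 0 .nil .nil (.leaf 0 2 [2] 4) (.leaf 0 3 [2]
    4) (.del 1 (.leaf 0 1 [0, 2] 0) .nil))) (.col 0 .nil (.leaf 0 1 [2] 4) (.leaf 0 2 [2] 4) (.leaf
    0 3 [2] 4) (.col 1 .nil (.leaf 0 1 [0, 2] 0) (.leaf 0 2 [0, 2] 0) (.leaf 0 3 [0, 2] 0) (.col 2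
    .nil (.leaf 0 1 [0, 1] 0) (.leaf 0 2 [0, 1] 0) (.leaf 0 3 [0, 1] 0) (.del 10 (.node 3 0 (.node
    0 1 (.leaf 0 1 [0, 1] 0) (.col 0 .nil .nil (.leaf 0 2 [1, 3] 0) (.leaf 0 3 [1, 3] 0) (.del 1
    (.leaf 0 1 [0, 2] 0) .nil))) (.col 0 .nil (.leaf 0 1 [1, 3] 0) (.leaf 0 2 [1, 3] 0) (.leaf 0 3
    [1, 3] 0) (.col 1 .nil (.leaf 0 1 [0, 2] 0) (.leaf 0 2 [0, 2] 0) (.leaf 0 3 [0, 2] 0) (.col 2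
    .nil (.leaf 0 1 [0, 1] 0) (.leaf 0 2 [0, 1] 0) (.leaf 0 3 [0, 1] 0) (.col 3 .nil (.leaf 0 1 [1,
    0] 0) (.leaf 0 2 [1, 0] 0) (.leaf 0 3 [1, 0] 0) .nil))))) .nil))))) .nil))))))) .nil))))))))

set_option maxRecDepth 100000 in
theorem startCert_check : startCert.check false startPattern = true := by
  decide +kernel

section
variable {W : Type} {H : SimpleGraph W} {U U' : Set W} {Φ Φ' : W → Set ℕ} {f : ℕ → W} {ρ : W → ℕ}

theorem bobForces_of_list [Finite W] {a : W} {L : List W} {c₁ c₂ x : ℕ}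
    (hch : (a :: L).IsChain H.Adj) (hnd : (a :: L).Nodup) (hU : ∀ y ∈ a :: L, y ∈ U)
    (ne : c₁ ≠ c₂) (lt₁ : c₁ < 4) (lt₂ : c₂ < 4) (ltx : x < 4) (mem₁ : c₁ ∈ Φ a) (mem₂ : c₂ ∈ Φ a)
    (memx : x ∈ Φ (L.getLastD a)) (parity : L.length % 2 = 1 ↔ (x = c₁ ∨ x = c₂)) :
    BobForces 4 H (2 * Nat.card W + 1) U Φ := by
  have hlt : ∀ i ≤ L.length, i < (a :: L).length := fun i hi => by simp; omega
  have hget : ∀ i (hi : i ≤ L.length), (a :: L).getD i a = (a :: L)[i]'(hlt i hi) := fun i hi => by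
    simp [List.getD_eq_getElem?_getD, List.getElem?_eq_getElem (hlt i hi)]
  have hT : Threat H U Φ (fun i => (a :: L).getD i a) L.length c₁ c₂ x := by
    refine ⟨⟨fun i hi => ?_, fun i hi => ?_, fun i hi j hj h => ?_⟩, ne, lt₁, lt₂, ltx, ?_, ?_, ?_,
      parity⟩
    · simp only [hget i hi]
      exact hU _ (List.getElem_mem _)
    · simp only [hget i hi.le, hget (i + 1) hi]
      exact List.isChain_iff_getElem.1 hch i (by simp; omega)
    · simp only [hget i hi, hget j hj] at h
      exact (hnd.getElem_inj_iff).1 h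
    · simpa using mem₁
    · simpa using mem₂
    · have : (a :: L).getD L.length a = L.getLastD a := by
        rw [hget _ le_rfl]
        rcases L.eq_nil_or_concat with rfl | ⟨L', b, rfl⟩ <;> simp
      simpa only [this] using memx
  have hle : L.length ≤ Nat.card W := by
    have := Fintype.ofFinite W
    have h1 := hnd.length_le_card
    rw [Nat.card_eq_fintype_card]
    simp at h1
    omega
  exact (hT.bobForces).of_le (by omega)

/-- A route from `w` whose further vertices are labelled `e`, ending where `x` is forbidden, of
parity given by `o`. -/
def TailRoute (H : SimpleGraph W) (U : Set W) (Φ : W → Set ℕ) (ρ : W → ℕ) (w : W) (e : ℕ)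
    (o : Bool) (x : ℕ) : Prop :=
  ∃ l : List W, (w :: l).IsChain H.Adj ∧ l.Nodup ∧ (∀ y ∈ l, y ∈ U ∧ ρ y = e) ∧
    x ∈ Φ (l.getLastD w) ∧ (l.length % 2 = 1 ↔ o = true)

/-- The meaning of a tail at `w`. -/
def TailOK (H : SimpleGraph W) (U : Set W) (Φ : W → Set ℕ) (ρ : W → ℕ) (w : W) (e : ℕ) :
    Tail → Prop
  | .none => True
  | .both => ∃ x < 4, ∀ o, TailRoute H U Φ ρ w e o x
  | .exact o x => x < 4 ∧ TailRoute H U Φ ρ w e o x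

/-- The position `(U, Φ)` contains the pattern `P`, with named vertices `f` and with every vertex
labelled by `ρ` with the constituent of the pattern it belongs to. -/
structure Realize (H : SimpleGraph W) (U : Set W) (Φ : W → Set ℕ) (f : ℕ → W) (ρ : W → ℕ)
    (P : Pattern) : Prop where
  name : ∀ i, P.al i = true → i < 8 ∧ f i ∈ U ∧ ρ (f i) = i
  eq_name : ∀ y ∈ U, ρ y < 8 → y = f (ρ y)
  ph : ∀ i c, P.al i = true → P.ph i c = true → c ∈ Φ (f i)
  tail : ∀ i, P.al i = true → TailOK H U Φ ρ (f i) (i + 8) (P.tl i)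
  link : P.lk = true → P.al 0 = true → P.al 1 = true → ∃ l : List W, l.length % 2 = 1 ∧
    (f 0 :: (l ++ [f 1])).IsChain H.Adj ∧ l.Nodup ∧ ∀ y ∈ l, y ∈ U ∧ ρ y = 16

theorem TailRoute.mono {ρ' : W → ℕ} {w : W} {e : ℕ} {o : Bool} {x : ℕ}
    (h : TailRoute H U Φ ρ w e o x) (hU : ∀ y ∈ U, ρ y = e → y ∈ U' ∧ ρ' y = e)
    (hΦ : ∀ y, Φ y ⊆ Φ' y) : TailRoute H U' Φ' ρ' w e o x := by
  obtain ⟨l, h1, h2, h3, h4, h5⟩ := h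
  exact ⟨l, h1, h2, fun y hy => hU y (h3 y hy).1 (h3 y hy).2, hΦ _ h4, h5⟩

theorem TailOK.mono {ρ' : W → ℕ} {w : W} {e : ℕ} {t : Tail} (h : TailOK H U Φ ρ w e t)
    (hU : ∀ y ∈ U, ρ y = e → y ∈ U' ∧ ρ' y = e) (hΦ : ∀ y, Φ y ⊆ Φ' y) :
    TailOK H U' Φ' ρ' w e t := by
  cases t with
  | none => trivial
  | both =>
    obtain ⟨x, hx, h⟩ := h
    exact ⟨x, hx, fun o => (h o).mono hU hΦ⟩
  | exact o x => exact ⟨h.1, h.2.mono hU hΦ⟩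

theorem Realize.mono {P P' : Pattern} (h : Realize H U Φ f ρ P) (hU' : U' ⊆ U)
    (hΦ : ∀ y, Φ y ⊆ Φ' y) (hal : ∀ i, P'.al i = true → P.al i = true)
    (hph : ∀ i c, P'.al i = true → P'.ph i c = true → P.ph i c = true ∨ c ∈ Φ' (f i))
    (htl : ∀ i, P'.tl i = .none ∨ P'.tl i = P.tl i) (hlk : P'.lk = true → P.lk = true)
    (gone : ∀ y ∈ U, y ∉ U' → (P'.al (ρ y) = false) ∧
      (∀ i, ρ y = i + 8 → P'.tl i = .none) ∧ (ρ y = 16 → P'.lk = false)) :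
    Realize H U' Φ' f ρ P' where
  name i hi := by
    obtain ⟨h1, h2, h3⟩ := h.name i (hal i hi)
    refine ⟨h1, ?_, h3⟩
    by_contra hn
    have := (gone _ h2 hn).1
    rw [h3, hi] at this
    exact absurd this (by simp)
  eq_name y hy := h.eq_name y (hU' hy)
  ph i c hi hc := (hph i c hi hc).elim (fun h' => hΦ _ (h.ph i c (hal i hi) h')) id
  tail i hi := by
    rcases htl i with h' | h'
    · rw [h']; trivial
    · by_cases hn : P'.tl i = .none
      · rw [hn]; trivial
      rw [h']
      refine (h.tail i (hal i hi)).mono (fun y hy hye => ⟨?_, hye⟩) hΦ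
      by_contra hc
      exact hn ((gone y hy hc).2.1 i hye)
  link hl h0 h1 := by
    obtain ⟨l, a1, a2, a3, a4⟩ := h.link (hlk hl) (hal 0 h0) (hal 1 h1)
    refine ⟨l, a1, a2, a3, fun y hy => ⟨?_, (a4 y hy).2⟩⟩
    by_contra hc
    have := (gone y (a4 y hy).1 hc).2.2 (a4 y hy).2
    rw [hl] at this
    exact absurd this (by simp)

theorem Realize.forbid {P : Pattern} (h : Realize H U Φ f ρ P) (v a : ℕ) :
    Realize H U (addColor Φ (f v) a) f ρ (P.forbid v a) := by
  refine h.mono subset_rfl (fun y b hb => Or.inl hb) (fun i hi => hi) (fun i c hi hc => ?_)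
    (fun i => Or.inr rfl) (fun h => h) (fun y hy hn => absurd hy hn)
  simp only [Pattern.forbid, Bool.or_eq_true, Bool.and_eq_true, beq_iff_eq] at hc
  rcases hc with hc | ⟨rfl, rfl⟩
  · exact Or.inl hc
  · exact Or.inr (Or.inr ⟨rfl, rfl⟩)

theorem Realize.restrict {P : Pattern} (h : Realize H U Φ f ρ P) (K : List ℕ) (hU' : U' ⊆ U)
    (hΦ : ∀ y, Φ y ⊆ Φ' y) (hK : ∀ y ∈ U, y ∉ U' → ρ y ∉ K) :
    Realize H U' Φ' f ρ (P.restrict K) := by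
  refine h.mono hU' hΦ (fun i hi => ?_)
    (fun i c hi hc => Or.inl hc) (fun i => ?_) (fun h => ?_) (fun y hy hn => ?_)
  · simp [Pattern.restrict] at hi
    exact hi.1
  · simp only [Pattern.restrict]
    cases K.elem (i + 8) <;> simp
  · simp [Pattern.restrict] at h
    exact h.1
  · have hw := hK y hy hn
    refine ⟨by simp [Pattern.restrict, hw], fun i hi => ?_, fun hi => ?_⟩
    · simp [Pattern.restrict, ← hi, hw]
    · simp [Pattern.restrict, ← hi, hw]

theorem Realize.del {P : Pattern} (h : Realize H U Φ f ρ P) {w : W} {g : ℕ} :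
    Realize H (U \ {w}) (spread H Φ w g) f ρ (P.del (ρ w)) := by
  refine h.mono Set.sdiff_subset (fun y b hb => Or.inl hb) (fun i hi => ?_)
    (fun i c hi hc => Or.inl hc) (fun i => ?_) (fun h => ?_) (fun y hy hn => ?_)
  · simp [Pattern.del] at hi
    exact hi.1
  · simp only [Pattern.del]
    cases (i + 8 == ρ w) <;> simp
  · simp [Pattern.del] at h
    exact h.1
  · obtain rfl : y = w := by
      by_contra hne
      exact hn ⟨hy, hne⟩
    refine ⟨by simp [Pattern.del], fun i hi => ?_, fun hi => ?_⟩
    · simp [Pattern.del, ← hi]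
    · simp [Pattern.del, ← hi]

theorem Realize.paint {P : Pattern} (h : Realize H U Φ f ρ P)
    (hf : ∀ i j, namedAdj i j = true → H.Adj (f i) (f j)) {i g : ℕ} (hi : P.al i = true)
    (hg : g < 4) :
    ∃ ρ', Realize H (U \ {f i}) (spread H Φ (f i) g) f ρ' (P.paint i g) := by
  obtain ⟨hi8, hiU, hiρ⟩ := h.name i hi
  have hph : ∀ j c, (P.paint i g).ph j c = true → P.ph j c = true ∨
      c ∈ spread H Φ (f i) g (f j) := by
    intro j c hc
    simp only [Pattern.paint, Bool.or_eq_true, Bool.and_eq_true, beq_iff_eq] at hc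
    rcases hc with hc | ⟨hc, rfl⟩
    · exact Or.inl hc
    · exact Or.inr (Or.inr ⟨hf _ _ hc, rfl⟩)
  by_cases hlk : P.lk = true ∧ (i = 0 ∨ i = 1)
  · obtain ⟨hlk, hi01⟩ := hlk
    have hlk' : (P.paint i g).lk = false := by
      rcases hi01 with rfl | rfl <;> simp [Pattern.paint]
    have hal : ∀ j, (P.paint i g).al j = true → P.al j = true ∧ j ≠ i := fun j hj => by
      simpa [Pattern.paint] using hj
    refine ⟨fun y => if ρ y = 16 then 9 - i else ρ y, ⟨fun j hj => ?_, fun y hy hy8 => ?_,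
      fun j c hj hc => ?_, fun j hj => ?_, fun h' => absurd (hlk'.symm.trans h') (by simp)⟩⟩
    · obtain ⟨hj, hji⟩ := hal j hj
      obtain ⟨a1, a2, a3⟩ := h.name j hj
      refine ⟨a1, ⟨a2, fun hc => hji ?_⟩, ?_⟩
      · rw [← a3, ← hiρ, show f j = f i from hc]
      · rw [if_neg (by omega), a3]
    · split_ifs at hy8 ⊢ with h16
      · omega
      · exact h.eq_name y hy.1 hy8
    · obtain ⟨hj, hji⟩ := hal j hj
      exact (hph j c hc).elim (fun h' => Or.inl (h.ph j c hj h')) id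
    · replace hj := hal j hj
      obtain ⟨hj, hji⟩ := hj
      obtain ⟨a1, a2, a3⟩ := h.name j hj
      by_cases hjo : i + j = 1
      · have htl : (P.paint i g).tl j = .exact true g := by
          have : (i = 0 ∧ j = 1) ∨ (i = 1 ∧ j = 0) := by omega
          rcases this with ⟨rfl, rfl⟩ | ⟨rfl, rfl⟩ <;> simp [Pattern.paint, hlk]
        rw [htl]
        refine ⟨hg, ?_⟩
        have hal0 : P.al 0 = true ∧ P.al 1 = true := by
          have : (i = 0 ∧ j = 1) ∨ (i = 1 ∧ j = 0) := by omega
          rcases this with ⟨rfl, rfl⟩ | ⟨rfl, rfl⟩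
          · exact ⟨hi, hj⟩
          · exact ⟨hj, hi⟩
        obtain ⟨l, b1, b2, b3, b4⟩ := h.link hlk hal0.1 hal0.2
        have key : ∀ l' : List W, l'.length = l.length → (∀ y, y ∈ l' ↔ y ∈ l) → l'.Nodup →
            (f j :: (l' ++ [f i])).IsChain H.Adj →
            TailRoute H (U \ {f i}) (spread H Φ (f i) g)
              (fun y => if ρ y = 16 then 9 - i else ρ y) (f j) (j + 8) true g := by
          intro l' c1 c2 c3 c4
          rcases l'.eq_nil_or_concat with rfl | ⟨l'', z, rfl⟩
          · simp at c1
            omega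
          simp only [List.concat_eq_append, List.append_assoc, List.singleton_append,
            List.isChain_cons_append_cons_cons] at c4
          refine ⟨l'' ++ [z], ?_, by simpa using c3, fun y hy => ?_, ?_, by
            rw [← c1] at b1; simpa using b1⟩
          · exact c4.1
          · have := b4 y ((c2 y).1 (by simpa using hy))
            refine ⟨⟨this.1, fun hc => ?_⟩, ?_⟩
            · rw [show y = f i from hc] at this
              omega
            · simp only [this.2, if_true]
              omega
          · rw [List.getLastD_concat]
            exact Or.inr ⟨c4.2.1.symm, rfl⟩
        have : (i = 0 ∧ j = 1) ∨ (i = 1 ∧ j = 0) := by omega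
        rcases this with ⟨rfl, rfl⟩ | ⟨rfl, rfl⟩
        · refine key l.reverse (by simp) (by simp) (by simpa using b3) ?_
          have := List.isChain_reverse.2 (b2.imp fun a b (hab : H.Adj a b) => hab.symm)
          simpa using this
        · exact key l rfl (fun _ => Iff.rfl) b3 b2
      · have htl : (P.paint i g).tl j = P.tl j := by
          have : ¬ ((i = 0 ∧ j = 1) ∨ (i = 1 ∧ j = 0)) := by omega
          have hb : ((i == 0 && j == 1) || (i == 1 && j == 0)) = false := by
            rw [Bool.eq_false_iff]
            simpa using this
          simp [Pattern.paint, hb]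
        rw [htl]
        refine (h.tail j hj).mono (fun y hy hye => ⟨⟨hy, fun hc => ?_⟩, ?_⟩)
          (fun y b hb => Or.inl hb)
        · rw [show y = f i from hc] at hye
          omega
        · rw [if_neg (by omega), hye]
  · refine ⟨ρ, h.mono Set.sdiff_subset (fun y b hb => Or.inl hb) (fun j hj => ?_)
      (fun j c hj hc => hph j c hc) (fun j => Or.inr ?_) (fun h' => ?_) (fun y hy hn => ?_)⟩
    · simp [Pattern.paint] at hj
      exact hj.1
    · simp only [Pattern.paint]
      have : (P.lk && ((i == 0 && j == 1) || (i == 1 && j == 0))) = false := by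
        rw [Bool.eq_false_iff]
        intro h'
        simp at h'
        exact hlk ⟨h'.1, by omega⟩
      simp [this]
    · simp [Pattern.paint] at h'
      exact h'.1.1
    · obtain rfl : y = f i := by
        by_contra hne
        exact hn ⟨hy, hne⟩
      rw [hiρ]
      exact ⟨by simp [Pattern.paint], fun j hj => by omega, fun hj => by omega⟩

theorem Pattern.isPath_cons {P : Pattern} {v : ℕ} {r : List ℕ} (h : P.isPath (v :: r) = true) :
    (v :: r).IsChain (fun i j => namedAdj i j = true) ∧ (v :: r).Nodup ∧
      ∀ i ∈ v :: r, P.al i = true := by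
  induction r generalizing v with
  | nil =>
    simp [Pattern.isPath] at h
    simpa using h
  | cons w r ih =>
    rw [Pattern.isPath] at h
    simp only [Bool.and_eq_true, Bool.not_eq_true', List.elem_eq_mem, decide_eq_false_iff_not] at h
    obtain ⟨⟨h1, h2⟩, h3, h4⟩ := h
    obtain ⟨a1, a2, a3⟩ := ih h4
    refine ⟨List.isChain_cons_cons.2 ⟨h3, a1⟩, List.nodup_cons.2 ⟨h2, a2⟩, fun i hi => ?_⟩
    rcases List.mem_cons.1 hi with rfl | hi
    · exact h1
    · exact a3 i hi

theorem Realize.bobForces_of_isThreat [Finite W] {P : Pattern} (h : Realize H U Φ f ρ P)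
    (hf : ∀ i j, namedAdj i j = true → H.Adj (f i) (f j)) {c₁ c₂ e : ℕ} {p : List ℕ}
    (hp : P.isThreat c₁ c₂ p e = true) : BobForces 4 H (2 * Nat.card W + 1) U Φ := by
  rw [Pattern.isThreat] at hp
  simp only [Bool.and_eq_true, bne_iff_ne, decide_eq_true_eq] at hp
  obtain ⟨⟨⟨⟨⟨⟨ne, lt₁⟩, lt₂⟩, hpath⟩, m1⟩, m2⟩, hend⟩ := hp
  cases p with
  | nil => simp [Pattern.isPath] at hpath
  | cons v r =>
  obtain ⟨hch, hnd, hal⟩ := Pattern.isPath_cons hpath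
  have hinj : ∀ i ∈ v :: r, ∀ j ∈ v :: r, f i = f j → i = j := fun i hi j hj hij => by
    rw [← (h.name i (hal i hi)).2.2, hij, (h.name j (hal j hj)).2.2]
  have hch' : ((v :: r).map f).IsChain H.Adj := (List.isChain_map f).2 (hch.imp hf)
  have hnd' : ((v :: r).map f).Nodup := (List.nodup_map_iff_inj_on hnd).2 hinj
  have hU' : ∀ y ∈ (v :: r).map f, y ∈ U ∧ ρ y < 8 := fun y hy => by
    obtain ⟨i, hi, rfl⟩ := List.mem_map.1 hy
    obtain ⟨a1, a2, a3⟩ := h.name i (hal i hi)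
    exact ⟨a2, by omega⟩
  have hv := hal v (by simp)
  have key : ∀ {x o e}, x < 4 → 8 ≤ e → TailRoute H U Φ ρ (f (r.getLastD v)) e o x →
      ((r.length + bif o then 1 else 0) % 2 = 1 ↔ (x = c₁ ∨ x = c₂)) →
      BobForces 4 H (2 * Nat.card W + 1) U Φ := by
    intro x o e hx he ⟨l, b1, b2, b3, b4, b5⟩ hpar
    refine bobForces_of_list (a := f v) (L := r.map f ++ l) (x := x) ?_ ?_ ?_ ne lt₁ lt₂ hx
      (h.ph v c₁ hv m1) (h.ph v c₂ hv m2) ?_ ?_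
    · rcases r.eq_nil_or_concat with rfl | ⟨r', z, rfl⟩
      · simpa using b1
      · simp only [List.concat_eq_append, List.getLastD_concat] at b1 hch' ⊢
        simp only [List.map_append, List.map_cons, List.map_nil, List.append_assoc,
          List.singleton_append, List.isChain_cons_split (l₂ := l)] at hch' ⊢
        exact ⟨hch', b1⟩
    · rw [← List.cons_append, List.nodup_append]
      refine ⟨hnd', b2, fun y hy z hz hyz => ?_⟩
      have := (hU' y hy).2
      rw [hyz, (b3 z hz).2] at this
      omega
    · intro y hy
      rw [← List.cons_append, List.mem_append] at hy
      exact hy.elim (fun hy => (hU' y hy).1) (fun hy => (b3 y hy).1)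
    · rcases l.eq_nil_or_concat with rfl | ⟨l', z, rfl⟩
      · rcases r.eq_nil_or_concat with rfl | ⟨r', z, rfl⟩
        · simpa using b4
        · simp only [List.concat_eq_append, List.getLastD_concat, List.getLastD_nil] at b4
          simpa using b4
      · simp only [List.concat_eq_append, List.getLastD_concat] at b4
        simpa using b4
    · rw [← hpar]
      cases o <;> simp at b5 ⊢ <;> omega
  have hlast : P.al (r.getLastD v) = true := hal _ (by
    rcases r.eq_nil_or_concat with rfl | ⟨r', z, rfl⟩ <;> simp)
  have hlast' : (v :: r).getLastD 0 = r.getLastD v := List.getLastD_cons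
  rw [hlast', List.length_cons] at hend
  by_cases he : e < 4
  · simp only [he, decide_true, cond_true, Bool.and_eq_true, beq_iff_eq] at hend
    refine key (o := false) (e := 8) he le_rfl ⟨[], by simp, by simp, by simp, ?_, by simp⟩ ?_
    · exact h.ph _ _ hlast hend.1
    · have := hend.2
      rw [Bool.eq_iff_iff] at this
      simp at this ⊢
      rw [← this]
      omega
  · simp only [he, decide_false, cond_false] at hend
    have htl := h.tail _ hlast
    revert hend htl
    cases P.tl (r.getLastD v) with
    | none => simp
    | both =>
      rintro - ⟨x, hx, hr⟩
      by_cases hc : (r.length % 2 = 1 ↔ (x = c₁ ∨ x = c₂))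
      · exact key hx (by omega) (hr false) (by simpa using hc)
      · refine key hx (by omega) (hr true) ?_
        simp
        omega
    | exact o x =>
      rintro hend ⟨hx, hr⟩
      refine key hx (by omega) hr ?_
      simp only [beq_iff_eq] at hend
      rw [Bool.eq_iff_iff] at hend
      simp at hend
      rw [← hend]
      omega

/-- Correctness of the verification of strategies. -/
theorem Realize.bobForces [Finite W]
    (hf : ∀ i j, namedAdj i j = true → H.Adj (f i) (f j)) : ∀ (C : Cert) {U : Set W}
    {Φ : W → Set ℕ} {ρ : W → ℕ} {P : Pattern}, Realize H U Φ f ρ P →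
    (C.check false P = true → BobForces 4 H (C.depth + (2 * Nat.card W + 1)) U Φ) ∧
    (C.check true P = true → ∀ w ∈ U, ∀ g < 4, g ∉ Φ w → ρ w ∈ C.keys →
      BobForces 4 H (C.depth + (2 * Nat.card W + 1)) (U \ {w}) (spread H Φ w g)) := by
  intro C
  induction C with
  | leaf c₁ c₂ p e =>
    intro U Φ ρ P h
    refine ⟨fun hc => ?_, fun hc => by simp [Cert.check] at hc⟩
    simp only [Cert.check, Bool.not_false, Bool.true_and] at hc
    exact (h.bobForces_of_isThreat hf hc).of_le (by omega)
  | node v a C R ihC ihR =>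
    intro U Φ ρ P h
    refine ⟨fun hc => ?_, fun hc => by simp [Cert.check] at hc⟩
    simp only [Cert.check, Bool.not_false, Bool.true_and, Bool.and_eq_true,
      decide_eq_true_eq] at hc
    obtain ⟨⟨⟨hv, ha⟩, hC⟩, hR⟩ := hc
    have hforb := h.forbid v a
    rw [show (Cert.node v a C R).depth + (2 * Nat.card W + 1) =
      max C.depth R.depth + (2 * Nat.card W + 1) + 1 by simp [Cert.depth]; omega]
    refine Or.inr ⟨f v, (h.name v hv).2.1, a, ha, ?_, fun w hw g hg hgw => ?_⟩
    · exact ((ihC (hforb.restrict R.keys subset_rfl (fun _ => subset_rfl)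
        fun y hy hn => absurd hy hn)).1 hC).of_le (by omega)
    · by_cases hk : ρ w ∈ R.keys
      · exact ((ihR hforb).2 hR w hw g hg hgw hk).of_le (by omega)
      · refine ((ihC (hforb.restrict R.keys Set.sdiff_subset (fun y b hb => Or.inl hb)
          fun y hy hn => ?_)).1 hC).of_le (by omega)
        obtain rfl : y = w := by
          by_contra hne
          exact hn ⟨hy, hne⟩
        exact hk
  | nil =>
    intro U Φ ρ P h
    exact ⟨fun hc => by simp [Cert.check] at hc, fun _ w _ g _ _ hk => by simp [Cert.keys] at hk⟩
  | del e C R ihC ihR =>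
    intro U Φ ρ P h
    refine ⟨fun hc => by simp [Cert.check] at hc, fun hc w hw g hg hgw hk => ?_⟩
    simp only [Cert.check, Bool.true_and, Bool.and_eq_true] at hc
    simp only [Cert.depth]
    by_cases hwe : ρ w = e
    · subst hwe
      exact ((ihC h.del).1 hc.1).of_le (by omega)
    · simp only [Cert.keys, List.mem_cons, hwe, false_or] at hk
      exact ((ihR h).2 hc.2 w hw g hg hgw hk).of_le (by omega)
  | col i C₀ C₁ C₂ C₃ R ih₀ ih₁ ih₂ ih₃ ihR =>
    intro U Φ ρ P h
    refine ⟨fun hc => by simp [Cert.check] at hc, fun hc w hw g hg hgw hk => ?_⟩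
    simp only [Cert.check, Bool.true_and, Bool.and_eq_true, Bool.or_eq_true] at hc
    obtain ⟨⟨⟨⟨⟨hi, h0⟩, h1⟩, h2⟩, h3⟩, hR⟩ := hc
    simp only [Cert.depth]
    by_cases hwe : ρ w = i
    · obtain ⟨hi8, -, -⟩ := h.name i hi
      obtain rfl : w = f i := by rw [h.eq_name w hw (by omega), hwe]
      have hph : P.ph i g ≠ true := fun hc => hgw (h.ph i g hi hc)
      obtain ⟨ρ', h'⟩ := h.paint hf hi hg
      interval_cases g
      · exact ((ih₀ h').1 (h0.resolve_left hph)).of_le (by omega)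
      · exact ((ih₁ h').1 (h1.resolve_left hph)).of_le (by omega)
      · exact ((ih₂ h').1 (h2.resolve_left hph)).of_le (by omega)
      · exact ((ih₃ h').1 (h3.resolve_left hph)).of_le (by omega)
    · simp only [Cert.keys, List.mem_cons, hwe, false_or] at hk
      exact ((ihR h).2 hR w hw g hg hgw hk).of_le (by omega)

end

/-- The graph obtained from `H` by attaching a pendant vertex to every vertex for every element
of `ι`. -/
def leafy {W : Type} (H : SimpleGraph W) (ι : Type) : SimpleGraph (W × Option ι) where
  Adj x y := (x.2 = none ∧ y.2 = none ∧ H.Adj x.1 y.1) ∨ (x.1 = y.1 ∧ (x.2 = none ↔ y.2 ≠ none))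
  symm := ⟨fun x y h => h.imp (fun h => ⟨h.2.1, h.1, h.2.2.symm⟩) fun h => ⟨h.1.symm, by
    have := h.2
    tauto⟩⟩
  loopless := ⟨fun x h => by
    rcases h with h | h
    · exact H.irrefl h.2.2
    · have := h.2
      tauto⟩

theorem not_aliceWins_of_dead {V α : Type} [DecidableEq V] {G : SimpleGraph V} {p : Player}
    {c : V → Option α} {v : V} (hv : c v = none) (h : ∀ a, a ∈ Phi G c v) :
    ¬ AliceWins G p c := by
  intro hw
  have step : ∀ {c : V → Option α} {w : V} {b : α}, c v = none → (∀ a, a ∈ Phi G c v) →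
      legalMove G c w b → applyMove c w b v = none ∧ ∀ a, a ∈ Phi G (applyMove c w b) v := by
    intro c w b hv h hl
    have hwv : v ≠ w := by
      rintro rfl
      obtain ⟨u, hu, hc⟩ := h b
      exact hl.2 u hu hc
    refine ⟨by simp [applyMove, hwv, hv], fun a => ?_⟩
    obtain ⟨u, hu, hc⟩ := h a
    refine ⟨u, hu, ?_⟩
    have : u ≠ w := by
      rintro rfl
      rw [hl.1] at hc
      exact absurd hc (by simp)
    simp [applyMove, this, hc]
  induction hw with
  | endPos p c hend hall => exact hall v hv
  | aliceMove c w b hl _ ih => exact ih (step hv h hl).1 (step hv h hl).2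
  | bobMove c hm _ ih =>
    obtain ⟨w, b, hl⟩ := hm
    exact ih w b hl (step hv h hl).1 (step hv h hl).2

theorem AliceWins.bob_inv {V α : Type} [DecidableEq V] {G : SimpleGraph V} {c : V → Option α}
    (h : AliceWins G .bob c) {v : V} {a : α} (hl : legalMove G c v a) :
    AliceWins G .alice (applyMove c v a) := by
  cases h with
  | endPos _ _ hend _ => exact absurd hl (hend v a)
  | bobMove _ _ h => exact h v a hl

theorem AliceWins.alice_inv {V α : Type} [DecidableEq V] {G : SimpleGraph V} {c : V → Option α}
    (h : AliceWins G .alice c) {v : V} (hv : c v = none) :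
    ∃ w a, legalMove G c w a ∧ AliceWins G .bob (applyMove c w a) := by
  cases h with
  | endPos _ _ _ hall => exact absurd hv (hall v)
  | aliceMove _ w a hl h => exact ⟨w, a, hl, h⟩

section
variable {W : Type} {H : SimpleGraph W} {ℓ q : ℕ}

/-- Every vertex of `W` has at least `m` uncoloured leaves. -/
def FreeLeaves (c : W × Option (Fin ℓ) → Option (Fin q)) (m : ℕ) : Prop :=
  ∀ v, ∃ S : Finset (Fin ℓ), m ≤ S.card ∧ ∀ i ∈ S, c (v, some i) = none

theorem FreeLeaves.mono {c : W × Option (Fin ℓ) → Option (Fin q)} {m n : ℕ}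
    (h : FreeLeaves c n) (hmn : m ≤ n) : FreeLeaves c m := fun v =>
  let ⟨S, h1, h2⟩ := h v
  ⟨S, hmn.trans h1, h2⟩

/-- Every colour below `q` recorded in `Φ` at an element of `U` is present in its
neighbourhood. -/
def Records (H : SimpleGraph W) (c : W × Option (Fin ℓ) → Option (Fin q)) (U : Set W)
    (Φ : W → Set ℕ) : Prop :=
  ∀ v ∈ U, c (v, none) = none ∧ ∀ a : Fin q, a.1 ∈ Φ v → a ∈ Phi (leafy H (Fin ℓ)) c (v, none)

variable [DecidableEq W]

theorem FreeLeaves.applyMove {c : W × Option (Fin ℓ) → Option (Fin q)} {m : ℕ}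
    (h : FreeLeaves c (m + 1)) (w : W × Option (Fin ℓ)) (a : Fin q) :
    FreeLeaves (applyMove c w a) m := by
  intro v
  obtain ⟨S, h1, h2⟩ := h v
  obtain ⟨w, o⟩ := w
  cases o with
  | none => exact ⟨S, by omega, fun i hi => by simp [GCN.applyMove, h2 i hi]⟩
  | some j =>
    refine ⟨S.erase j, ?_, fun i hi => ?_⟩
    · have := Finset.pred_card_le_card_erase (s := S) (a := j)
      omega
    · rw [Finset.mem_erase] at hi
      simp [GCN.applyMove, h2 i hi.2, hi.1]

theorem Phi_applyMove {V α : Type} [DecidableEq V] {G : SimpleGraph V} {c : V → Option α}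
    {w v : V} {a b : α} (hw : c w = none) (h : a ∈ Phi G c v) : a ∈ Phi G (applyMove c w b) v := by
  obtain ⟨u, hu, hc⟩ := h
  refine ⟨u, hu, ?_⟩
  have : u ≠ w := by
    rintro rfl
    rw [hw] at hc
    exact absurd hc (by simp)
  simp [applyMove, this, hc]

theorem not_aliceWins_of_bobForces : ∀ (n : ℕ) {U : Set W} {Φ : W → Set ℕ}
    {c : W × Option (Fin ℓ) → Option (Fin q)}, BobForces q H n U Φ → Records H c U Φ →
    FreeLeaves c (2 * n) → ¬ AliceWins (leafy H (Fin ℓ)) .bob c := by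
  have dead : ∀ {U : Set W} {Φ : W → Set ℕ} {c : W × Option (Fin ℓ) → Option (Fin q)} {v : W},
      v ∈ U → (∀ a < q, a ∈ Φ v) → Records H c U Φ → ¬ AliceWins (leafy H (Fin ℓ)) .bob c :=
    fun hv h hr => not_aliceWins_of_dead (hr _ hv).1 fun a => (hr _ hv).2 a (h a a.2)
  intro n
  induction n with
  | zero =>
    rintro U Φ c ⟨v, hv, h⟩ hr -
    exact dead hv h hr
  | succ n ih =>
    rintro U Φ c (⟨v, hv, h⟩ | ⟨v, hv, a, ha, h0, h⟩) hr hf hA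
    · exact dead hv h hr hA
    obtain ⟨S, hS, hS'⟩ := hf v
    obtain ⟨i, hi⟩ : S.Nonempty := by
      rw [← Finset.card_pos]
      omega
    have hl : legalMove (leafy H (Fin ℓ)) c (v, some i) (⟨a, ha⟩ : Fin q) := by
      refine ⟨hS' i hi, ?_⟩
      rintro ⟨u, o⟩ (hu | hu)
      · exact absurd hu.1 (by simp)
      · obtain ⟨hu1, hu2⟩ := hu
        simp at hu1 hu2
        subst hu1 hu2
        rw [(hr v hv).1]
        simp
    have hr' : Records H (applyMove c (v, some i) (⟨a, ha⟩ : Fin q)) U (addColor Φ v a) := by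
      intro y hy
      refine ⟨by simp [applyMove, (hr y hy).1], fun b hb => ?_⟩
      rcases hb with hb | ⟨rfl, hb⟩
      · exact Phi_applyMove hl.1 ((hr y hy).2 b hb)
      · refine ⟨(y, some i), Or.inr (by simp), ?_⟩
        have : b = ⟨a, ha⟩ := Fin.ext hb
        simp [applyMove, this]
    have hf' : FreeLeaves (applyMove c (v, some i) (⟨a, ha⟩ : Fin q)) (2 * n + 1) :=
      FreeLeaves.applyMove (hf.mono (by omega)) _ _
    obtain ⟨⟨w, o⟩, g, hlw, hA'⟩ := (hA.bob_inv hl).alice_inv (hr' v hv).1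
    have hf'' := hf'.applyMove (w, o) g
    by_cases hw : w ∈ U ∧ o = none
    · obtain ⟨hw, rfl⟩ := hw
      refine ih (h w hw g g.2 fun hg => ?_) ?_ hf'' hA'
      · obtain ⟨u, hu, hc⟩ := (hr' w hw).2 g hg
        exact hlw.2 u hu hc
      · rintro y ⟨hy, hyw⟩
        have hyw : y ≠ w := hyw
        refine ⟨by simpa [applyMove, hyw] using (hr y hy).1, fun b hb => ?_⟩
        rcases hb with hb | ⟨hb, hb'⟩
        · exact Phi_applyMove hlw.1 ((hr' y hy).2 b hb)
        · refine ⟨(w, none), Or.inl ⟨rfl, rfl, hb.symm⟩, ?_⟩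
          have : b = g := Fin.ext hb'
          simp [applyMove, this]
    · refine ih h0 (fun y hy => ⟨?_, fun b hb => ?_⟩) hf'' hA'
      · have : ((y, none) : W × Option (Fin ℓ)) ≠ (w, o) := by
          rintro ⟨⟩
          exact hw ⟨hy, rfl⟩
        simp only [GCN.applyMove, Function.update_of_ne this]
        exact (hr' y hy).1
      · exact Phi_applyMove hlw.1 ((hr' y hy).2 b hb)

end

theorem AliceWins.exists_coloring {V α : Type} [DecidableEq V] {G : SimpleGraph V} {p : Player}
    {c : V → Option α} (h : AliceWins G p c) (hc : ProperPartial G c) :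
    Nonempty (G.Coloring α) := by
  have step : ∀ {c : V → Option α} {w : V} {b : α}, ProperPartial G c → legalMove G c w b →
      ProperPartial G (applyMove c w b) := by
    intro c w b hc hl u v huv a hu hv
    by_cases h1 : u = w
    · subst h1
      simp only [applyMove, Function.update_self, Function.update_of_ne huv.ne'] at hu hv
      exact hl.2 v huv (hv.trans hu.symm)
    · by_cases h2 : v = w
      · subst h2
        simp only [applyMove, Function.update_self, Function.update_of_ne huv.ne] at hu hv
        exact hl.2 u huv.symm (hu.trans hv.symm)
      · simp only [applyMove, Function.update_of_ne h1, Function.update_of_ne h2] at hu hv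
        exact hc huv a hu hv
  induction h with
  | endPos p c hend hall =>
    choose f hf using fun v => Option.ne_none_iff_exists'.1 (hall v)
    exact ⟨SimpleGraph.Coloring.mk f fun {u v} huv h => hc huv (f u) (hf u) (h ▸ hf v)⟩
  | aliceMove c v a hl _ ih => exact ih (step hc hl)
  | bobMove c hm _ ih =>
    obtain ⟨v, a, hl⟩ := hm
    exact ih v a hl (step hc hl)

section
variable {W : Type} {H : SimpleGraph W}

theorem BobForces.of_two {U : Set W} {Φ : W → Set ℕ} {v : W} {a b : ℕ} (hv : v ∈ U)
    (ha : a < 3) (hb : b < 3) (hab : a ≠ b) (hav : a ∈ Φ v) (hbv : b ∈ Φ v) (n : ℕ) :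
    BobForces 3 H (n + 1) U Φ := by
  refine .of_one_left (b := 3 - a - b) hv (by omega) (fun x hx => ?_) n
  by_cases h1 : x = a
  · exact Or.inl (h1 ▸ hav)
  · by_cases h2 : x = b
    · exact Or.inl (h2 ▸ hbv)
    · right
      omega

theorem bobForces_three_of_pair {u r : W} (hur : H.Adj u r) {Φ : W → Set ℕ} {g : ℕ} (hg : g < 3)
    (hgu : g ∈ Φ u) : BobForces 3 H 3 {u, r} Φ := by
  have hu : u ∈ ({u, r} : Set W) := Or.inl rfl
  have hr : r ∈ ({u, r} : Set W) := Or.inr rfl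
  have key : ∀ {Φ : W → Set ℕ}, g ∈ Φ u → g ∈ Φ r → ∀ w ∈ ({u, r} : Set W), ∀ b < 3, b ∉ Φ w →
      ∀ n, BobForces 3 H (n + 1) ({u, r} \ {w}) (spread H Φ w b) := by
    rintro Φ hgu hgr w hw b hb hbw n
    obtain ⟨v, hv, hwv, hgv, hgw⟩ : ∃ v ∈ ({u, r} : Set W), H.Adj w v ∧ g ∈ Φ v ∧ g ∈ Φ w := by
      rcases hw with rfl | rfl
      · exact ⟨r, hr, hur, hgr, hgu⟩
      · exact ⟨u, hu, hur.symm, hgu, hgr⟩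
    have hbv : b ∈ spread H Φ w b v := Or.inr ⟨hwv, rfl⟩
    have hv' : v ∈ ({u, r} : Set W) \ {w} := ⟨hv, hwv.ne'⟩
    exact .of_two hv' hg hb (fun h => hbw (h ▸ hgw)) (Or.inl hgv) hbv n
  have two : ∀ {Φ : W → Set ℕ}, g ∈ Φ u → g ∈ Φ r → BobForces 3 H 2 {u, r} Φ := by
    intro Φ hgu hgr
    obtain ⟨a, ha, hag⟩ : ∃ a < 3, g ≠ a := ⟨(g + 1) % 3, by omega, by omega⟩
    have hau : a ∈ addColor Φ u a u := Or.inr ⟨rfl, rfl⟩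
    exact Or.inr ⟨u, hu, a, ha, .of_two hu hg ha hag (Or.inl hgu) hau 0,
      fun w hw b hb hbw => key (Or.inl hgu) (Or.inl hgr) w hw b hb hbw 0⟩
  have hgr : g ∈ addColor Φ r g r := Or.inr ⟨rfl, rfl⟩
  exact Or.inr ⟨r, hr, g, hg, two (Or.inl hgu) hgr, fun w hw b hb hbw =>
    key (Or.inl hgu) hgr w hw b hb hbw 1⟩

theorem freeLeaves_none (W : Type) (ℓ q : ℕ) :
    FreeLeaves (fun _ => none : W × Option (Fin ℓ) → Option (Fin q)) ℓ :=
  fun _ => ⟨Finset.univ, by simp, fun _ _ => rfl⟩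

theorem not_aliceWins_three [DecidableEq W] [Nonempty W] {ℓ : ℕ} (hℓ : 7 ≤ ℓ)
    (hH : ∀ w, ∃ u r, H.Adj w u ∧ H.Adj u r ∧ r ≠ w) :
    ¬ AliceWins (leafy H (Fin ℓ)) .alice (fun _ => (none : Option (Fin 3))) := by
  intro hA
  obtain ⟨v⟩ := ‹Nonempty W›
  obtain ⟨⟨w, o⟩, g, hl, hA'⟩ := hA.alice_inv (v := (v, none)) rfl
  have hf : FreeLeaves (applyMove (fun _ => (none : Option (Fin 3))) (w, o) g) 6 :=
    FreeLeaves.applyMove ((freeLeaves_none W ℓ 3).mono hℓ) _ _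
  obtain ⟨u, r, hwu, hur, hrw⟩ := hH w
  have main : ∀ u r : W, H.Adj u r → ((u, none) : W × Option (Fin ℓ)) ≠ (w, o) →
      ((r, none) : W × Option (Fin ℓ)) ≠ (w, o) → (leafy H (Fin ℓ)).Adj (u, none) (w, o) →
      False := by
    intro u r hur hu hr hadj
    refine not_aliceWins_of_bobForces 3 (bobForces_three_of_pair (g := g)
      (Φ := fun y => {b | y = u ∧ b = g}) hur g.2 ⟨rfl, rfl⟩) (fun y hy => ⟨?_, ?_⟩) hf hA'
    · rcases hy with rfl | rfl
      · simp only [applyMove, Function.update_of_ne hu]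
      · simp only [applyMove, Function.update_of_ne hr]
    · rintro b ⟨rfl, hb⟩
      refine ⟨_, hadj, ?_⟩
      have : b = g := Fin.ext hb
      simp [applyMove, this]
  cases o with
  | none =>
    refine main u r hur ?_ ?_ (Or.inl ⟨rfl, rfl, hwu.symm⟩)
    · simpa using hwu.ne'
    · simpa using hrw
  | some i => exact main w u hwu (by simp) (by simp) (Or.inr ⟨rfl, by simp⟩)

end

section
variable {V : Type} {G : SimpleGraph V} {par mate : V → Option V} {r : V → ℕ} {q : ℕ}

/-- A parent function covering all edges of `G` except for a matching. -/
structure TreeLike (G : SimpleGraph V) (par mate : V → Option V) (r : V → ℕ) : Prop where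
  rank : ∀ u v, par u = some v → r v < r u
  adj : ∀ u v, G.Adj u v → par u = some v ∨ par v = some u ∨ mate u = some v

/-- The invariant maintained by Alice, for a set `A` of active vertices. -/
structure Activation (par : V → Option V) (c : V → Option (Fin q)) (A : Set V) : Prop where
  coloured : ∀ v, c v ≠ none → v ∈ A
  parent : ∀ u v, u ∈ A → par u = some v → v ∈ A
  child : ∀ v, c v = none → ∀ x ∈ A, ∀ y ∈ A, par x = some v → par y = some v → x = y

theorem exists_legalMove_of_card [DecidableEq V] {c : V → Option (Fin q)} {v : V} (hv : c v = none)
    {S : Finset V} (hS : S.card < q) (h : ∀ u, G.Adj v u → c u ≠ none → u ∈ S) :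
    ∃ a, legalMove G c v a := by
  have : ∃ a : Fin q, some a ∉ S.image c := by
    by_contra! hc
    have h1 : (Finset.univ : Finset (Fin q)).image some ⊆ S.image c := by
      intro x hx
      obtain ⟨a, -, rfl⟩ := Finset.mem_image.1 hx
      exact hc a
    have h2 := (Finset.card_le_card h1).trans Finset.card_image_le
    rw [Finset.card_image_of_injective _ (Option.some_injective _)] at h2
    simp at h2
    omega
  obtain ⟨a, ha⟩ := this
  refine ⟨a, hv, fun u hu hc => ha ?_⟩
  rw [← hc]
  exact Finset.mem_image_of_mem _ (h u hu (by simp [hc]))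

/-- The ancestors of a vertex, including itself. -/
def ancestors (par : V → Option V) (x : V) : Set V :=
  {u | Relation.ReflTransGen (fun a b => par a = some b) x u}

theorem TreeLike.exists_legalMove [DecidableEq V] (hG : TreeLike G par mate r)
    {c : V → Option (Fin 5)} {v : V} (hv : c v = none) {p z : V}
    (h : ∀ u, c u ≠ none → par u = some v → u = p ∨ u = z) : ∃ a, legalMove G c v a := by
  refine exists_legalMove_of_card hv (S := {p, z} ∪ (par v).toFinset ∪ (mate v).toFinset) ?_ ?_
  · have h1 : (par v).toFinset.card ≤ 1 := by cases par v <;> simp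
    have h2 : (mate v).toFinset.card ≤ 1 := by cases mate v <;> simp
    have h3 := Finset.card_union_le ({p, z} ∪ (par v).toFinset) (mate v).toFinset
    have h4 := Finset.card_union_le {p, z} (par v).toFinset
    have h5 : ({p, z} : Finset V).card ≤ 2 := Finset.card_le_two
    omega
  · intro u hu hc
    simp only [Finset.mem_union, Finset.mem_insert, Finset.mem_singleton, Option.mem_toFinset,
      Option.mem_def]
    rcases hG.adj v u hu with h1 | h1 | h1
    · exact Or.inl (Or.inr h1)
    · exact Or.inl (Or.inl (h u hc h1))
    · exact Or.inr h1

theorem Activation.exists_legalMove [DecidableEq V] (hG : TreeLike G par mate r)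
    {c : V → Option (Fin 5)} {A : Set V} (h : Activation par c A) {v : V} (hv : c v = none) :
    ∃ a, legalMove G c v a := by
  by_cases hp : ∃ p, c p ≠ none ∧ par p = some v
  · obtain ⟨p, hp, hpv⟩ := hp
    exact hG.exists_legalMove hv (p := p) (z := p) fun u hu huv =>
      Or.inl (h.child v hv u (h.coloured u hu) p (h.coloured p hp) huv hpv)
  · exact hG.exists_legalMove hv (p := v) (z := v) fun u hu huv => absurd ⟨u, hu, huv⟩ hp

theorem ancestors_total {x u v : V} (hu : u ∈ ancestors par x) (hv : v ∈ ancestors par x) :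
    v ∈ ancestors par u ∨ u ∈ ancestors par v :=
  Relation.ReflTransGen.total_of_right_unique
    (fun _ _ _ h h' => Option.some_injective _ (h.symm.trans h')) hu hv

theorem TreeLike.rank_le (hG : TreeLike G par mate r) {x u : V} (hu : u ∈ ancestors par x) :
    r u ≤ r x := by
  induction hu with
  | refl => exact le_rfl
  | tail _ h ih => exact (hG.rank _ _ h).le.trans ih

theorem mem_of_ancestors {A : Set V} (hA : ∀ u v, u ∈ A → par u = some v → v ∈ A) {x u : V}
    (hx : x ∈ A) (hu : u ∈ ancestors par x) : u ∈ A := by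
  induction hu with
  | refl => exact hx
  | tail _ h ih => exact hA _ _ ih h

theorem TreeLike.child_unique (hG : TreeLike G par mate r) {x u u' v : V}
    (hu : u ∈ ancestors par x) (hu' : u' ∈ ancestors par x) (h : par u = some v)
    (h' : par u' = some v) : u = u' := by
  have key : ∀ {u u'}, par u = some v → par u' = some v → u' ∈ ancestors par u → u = u' := by
    intro u u' h h' hanc
    rcases Relation.ReflTransGen.cases_head hanc with rfl | ⟨w, hw, hanc⟩
    · rfl
    · obtain rfl : w = v := Option.some_injective _ (hw.symm.trans h)
      have h1 := hG.rank_le hanc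
      have h2 := hG.rank _ _ h'
      omega
  rcases ancestors_total hu hu' with h1 | h1
  · exact key h h' h1
  · exact (key h' h h1).symm

theorem border_unique {A : Set V} (hA : ∀ u v, u ∈ A → par u = some v → v ∈ A) {x z z' y y' : V}
    (hz : z ∈ ancestors par x) (hz' : z' ∈ ancestors par x) (hzA : z ∉ A) (hzA' : z' ∉ A)
    (hy : par z = some y) (hy' : par z' = some y') (hyA : y ∈ A) (hyA' : y' ∈ A) : z = z' := by
  have key : ∀ {z z' y}, z' ∉ A → par z = some y → y ∈ A → z' ∈ ancestors par z → z = z' := by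
    intro z z' y hzA' hy hyA hanc
    rcases Relation.ReflTransGen.cases_head hanc with rfl | ⟨w, hw, hanc⟩
    · rfl
    · obtain rfl : w = y := Option.some_injective _ (hw.symm.trans hy)
      exact absurd (mem_of_ancestors hA hyA hanc) hzA'
  rcases ancestors_total hz hz' with h1 | h1
  · exact key hzA' hy hyA h1
  · exact (key hzA hy' hyA' h1).symm

theorem Activation.aliceWins [Fintype V] [DecidableEq V] (hG : TreeLike G par mate r) :
    ∀ (n : ℕ) {c : V → Option (Fin 5)} {A : Set V}, Activation par c A →
      (Finset.univ.filter fun v => c v = none).card = n →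
      AliceWins G .bob c ∧ AliceWins G .alice c := by
  intro n
  induction n using Nat.strong_induction_on with
  | _ n ih =>
  intro c A hA hn
  have hcard : ∀ {c : V → Option (Fin 5)} {v : V} {a : Fin 5}, c v = none →
      (Finset.univ.filter fun u => applyMove c v a u = none).card <
        (Finset.univ.filter fun u => c u = none).card := by
    intro c v a hv
    refine Finset.card_lt_card ⟨fun u hu => ?_, fun h => ?_⟩
    · simp only [Finset.mem_filter, Finset.mem_univ, true_and] at hu ⊢
      by_cases huv : u = v
      · rw [huv, hv]
      · simpa [applyMove, huv] using hu
    · have := h (Finset.mem_filter.2 ⟨Finset.mem_univ v, hv⟩)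
      rw [Finset.mem_filter] at this
      simp [applyMove] at this
  by_cases hex : ∃ v, c v = none
  swap
  · have : ∀ p, AliceWins G p c := fun p =>
      .endPos p c (fun v a hl => hex ⟨v, hl.1⟩) fun v hv => hex ⟨v, hv⟩
    exact ⟨this _, this _⟩
  constructor
  · obtain ⟨v, hv⟩ := hex
    obtain ⟨a, ha⟩ := hA.exists_legalMove hG hv
    refine .bobMove c ⟨v, a, ha⟩ fun x b hl => ?_
    have hx := hl.1
    have hlt := hcard (a := b) hx
    set c' := applyMove c x b with hc'
    have hcc' : ∀ v, c' v = none → c v = none := by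
      intro v hv
      by_cases hvx : v = x
      · rw [hvx, hx]
      · simpa [hc', applyMove, hvx] using hv
    have h1 : ∀ v, c' v ≠ none → v ∈ A ∪ ancestors par x := by
      intro v hv
      by_cases hvx : v = x
      · exact Or.inr (hvx ▸ Relation.ReflTransGen.refl)
      · exact Or.inl (hA.coloured v (by simpa [hc', applyMove, hvx] using hv))
    have h2 : ∀ u v, u ∈ A ∪ ancestors par x → par u = some v → v ∈ A ∪ ancestors par x := by
      rintro u v (hu | hu) huv
      · exact Or.inl (hA.parent u v hu huv)
      · exact Or.inr (Relation.ReflTransGen.tail hu huv)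
    have h3 : ∀ v, c v = none → (∀ z ∈ ancestors par x, z ∉ A → par z = some v → v ∉ A) →
        ∀ p ∈ A ∪ ancestors par x, ∀ y ∈ A ∪ ancestors par x, par p = some v → par y = some v →
        p = y := by
      intro v hv hno p hp y hy hpv hyv
      by_cases hpA : p ∈ A
      · by_cases hyA : y ∈ A
        · exact hA.child v hv p hpA y hyA hpv hyv
        · exact absurd (hA.parent p v hpA hpv) (hno y (hy.resolve_left hyA) hyA hyv)
      · by_cases hyA : y ∈ A
        · exact absurd (hA.parent y v hyA hyv) (hno p (hp.resolve_left hpA) hpA hpv)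
        · exact hG.child_unique (hp.resolve_left hpA) (hy.resolve_left hyA) hpv hyv
    by_cases hz : ∃ z ∈ ancestors par x, z ∉ A ∧ ∃ y ∈ A, par z = some y ∧ c' y = none
    · obtain ⟨z, hz, hzA, y, hyA, hzy, hy⟩ := hz
      have hch : ∃ p, ∀ u, c' u ≠ none → par u = some y → u = p ∨ u = z := by
        by_cases hp : ∃ p ∈ A, par p = some y
        · obtain ⟨p, hp, hpy⟩ := hp
          refine ⟨p, fun u hu huy => ?_⟩
          by_cases huA : u ∈ A
          · exact Or.inl (hA.child y (hcc' y hy) u huA p hp huy hpy)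
          · exact Or.inr (hG.child_unique ((h1 u hu).resolve_left huA) hz huy hzy)
        · exact ⟨z, fun u hu huy => Or.inr (hG.child_unique
            ((h1 u hu).resolve_left fun h => hp ⟨u, h, huy⟩) hz huy hzy)⟩
      obtain ⟨p, hp⟩ := hch
      obtain ⟨a', ha'⟩ := hG.exists_legalMove hy hp
      refine .aliceMove c' y a' ha' (ih _ ?_ (A := A ∪ ancestors par x) ⟨?_, h2, ?_⟩ rfl).1
      · exact (hcard hy).trans (hn ▸ hlt)
      · intro v hv
        by_cases hvy : v = y
        · exact Or.inl (hvy ▸ hyA)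
        · exact h1 v (by simpa [applyMove, hvy] using hv)
      · intro v hv
        have hvy : v ≠ y := by
          rintro rfl
          simp [applyMove] at hv
        refine h3 v (hcc' v (by simpa [applyMove, hvy] using hv)) fun z' hz' hzA' hzv hvA => hvy ?_
        have := border_unique hA.parent hz' hz hzA' hzA hzv hzy hvA hyA
        subst this
        exact Option.some_injective _ (hzv.symm.trans hzy)
    · refine (ih _ (hn ▸ hlt) (A := A ∪ ancestors par x) ⟨h1, h2, fun v hv => ?_⟩ rfl).2
      exact h3 v (hcc' v hv) fun z hz' hzA hzv hvA => hz ⟨z, hz', hzA, v, hvA, hzv, hv⟩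
  · obtain ⟨v, hv, hmin⟩ : ∃ v, c v = none ∧ ∀ u, c u = none → r v ≤ r u := by
      obtain ⟨v, hv⟩ := hex
      obtain ⟨w, hw, hmin⟩ := (Finset.univ.filter fun v => c v = none).exists_min_image r
        ⟨v, by simpa using hv⟩
      exact ⟨w, by simpa using hw, fun u hu => hmin u (by simpa using hu)⟩
    have hpar : ∀ u, par v = some u → c u ≠ none := fun u hu hc => by
      have h1 := hmin u hc
      have h2 := hG.rank _ _ hu
      omega
    obtain ⟨a, ha⟩ := hA.exists_legalMove hG hv
    refine .aliceMove c v a ha (ih _ (hn ▸ hcard hv) (A := insert v A) ⟨?_, ?_, ?_⟩ rfl).1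
    · intro u hu
      by_cases huv : u = v
      · exact Or.inl huv
      · exact Or.inr (hA.coloured u (by simpa [applyMove, huv] using hu))
    · rintro u w (rfl | hu) huw
      · exact Or.inr (hA.coloured w (hpar w huw))
      · exact Or.inr (hA.parent u w hu huw)
    · intro u hu
      have huv : u ≠ v := by
        rintro rfl
        simp [applyMove] at hu
      have hcu : c u = none := by simpa [applyMove, huv] using hu
      rintro x (rfl | hx) y (rfl | hy) hxu hyu
      · rfl
      · exact absurd hcu (hpar u hxu)
      · exact absurd hcu (hpar u hyu)
      · exact hA.child u hcu x hx y hy hxu hyu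

theorem TreeLike.aliceWins [Fintype V] [DecidableEq V] (hG : TreeLike G par mate r) :
    AliceWins G .alice (fun _ => (none : Option (Fin 5))) :=
  (Activation.aliceWins hG _ (A := ∅)
    ⟨fun _ h => absurd rfl h, fun _ _ h => absurd h (by simp), fun _ _ _ h => absurd h (by simp)⟩
    rfl).2

end

section
variable {V : Type} {G : SimpleGraph V}

/-- A cycle crossing a cut crosses it at least twice. -/
theorem exists_other_crossing {u : V} {c : G.Walk u u} (hc : c.IsCycle) {a b : V}
    (h : s(a, b) ∈ c.edges) {S : Set V} (ha : a ∈ S) (hb : b ∉ S) :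
    ∃ a' ∈ S, ∃ b' ∉ S, s(a', b') ∈ c.edges ∧ s(a', b') ≠ s(a, b) := by
  have hF : ∀ e ∈ c.edges, e ∈ (SimpleGraph.fromEdgeSet {e | e ∈ c.edges}).edgeSet := by
    intro e he
    rw [SimpleGraph.edgeSet_fromEdgeSet]
    exact ⟨he, G.not_isDiag_of_mem_edgeSet (c.edges_subset_edgeSet he)⟩
  have h1 := SimpleGraph.adj_and_reachable_delete_edges_iff_exists_cycle.2
    ⟨u, c.transfer _ hF, hc.transfer hF, by simpa using h⟩
  obtain ⟨p⟩ := h1.2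
  obtain ⟨d, hd, h2, h3⟩ := p.exists_boundary_dart S ha hb
  have h4 := d.adj
  rw [SimpleGraph.deleteEdges_adj] at h4
  exact ⟨d.fst, h2, d.snd, h3, by simpa using ((SimpleGraph.fromEdgeSet_adj _).1 h4.1).1, by
    simpa using h4.2⟩

theorem forall_mem_support_of_edges {Q : V → Prop} {u v : V} (p : G.Walk u v)
    (hu : Q u) (h : ∀ a b, s(a, b) ∈ p.edges → Q a → Q b) : ∀ w ∈ p.support, Q w := by
  induction p with
  | nil => simpa using hu
  | cons hadj p ih =>
    intro w hw
    rw [SimpleGraph.Walk.support_cons, List.mem_cons] at hw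
    rcases hw with rfl | hw
    · exact hu
    · exact ih (h _ _ (by simp) hu) (fun a b hab => h a b (by simp [hab])) w hw

/-- The length of a walk bounds the variation of a potential. -/
theorem walk_potential_le {φ : V → ℕ} (hφ : ∀ a b, G.Adj a b → φ b ≤ φ a + 1) {u v : V}
    (p : G.Walk u v) : φ v ≤ φ u + p.length := by
  induction p with
  | nil => simp
  | cons hadj p ih =>
    have := hφ _ _ hadj
    rw [SimpleGraph.Walk.length_cons]
    omega

theorem TreeLike.leafy {W ι : Type} {H : SimpleGraph W} {par mate : W → Option W} {r : W → ℕ}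
    (h : TreeLike H par mate r) :
    TreeLike (leafy H ι)
      (fun x => if x.2 = none then (par x.1).map (·, none) else some (x.1, none))
      (fun x => if x.2 = none then (mate x.1).map (·, none) else none)
      (fun x => 2 * r x.1 + if x.2 = none then 0 else 1) where
  rank := by
    rintro ⟨u, i⟩ ⟨v, j⟩ huv
    rcases i with _ | i
    · simp only [if_true, Option.map_eq_some_iff, Prod.mk.injEq] at huv
      obtain ⟨w, hw, rfl, rfl⟩ := huv
      have := h.rank _ _ hw
      simp
      omega
    · simp at huv
      obtain ⟨rfl, rfl⟩ := huv
      simp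
  adj := by
    rintro ⟨u, i⟩ ⟨v, j⟩ (⟨h1, h2, h3⟩ | ⟨h1, h2⟩)
    · simp only at h1 h2 h3
      subst h1 h2
      rcases h.adj _ _ h3 with h4 | h4 | h4 <;> simp [h4]
    · simp only at h1 h2
      subst h1
      rcases i with _ | i <;> rcases j with _ | j <;> simp at h2 ⊢

end

section
variable {n M T ℓ : ℕ}

/-- Consecutive numbers, and the two ends of an interval of length `n` starting at a multiple
of `M`. -/
def baseLink (n M a b : ℕ) : Prop := a + 1 = b ∨ (M ∣ a ∧ b + 1 = a + n)

/-- A path of `T` vertices with chords closing cycles of length `n` at all multiples of `M`. -/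
def base (n M T : ℕ) : SimpleGraph (Fin T) := SimpleGraph.fromRel fun a b => baseLink n M a b

theorem baseLink.lt (hn : 2 ≤ n) {a b : ℕ} (h : baseLink n M a b) : a < b := by
  unfold baseLink at h
  omega

theorem base_adj (hn : 2 ≤ n) {a b : Fin T} :
    (base n M T).Adj a b ↔ baseLink n M a b ∨ baseLink n M b a := by
  rw [base, SimpleGraph.fromRel_adj]
  refine and_iff_right_of_imp ?_
  rintro (h | h) rfl <;> exact absurd (h.lt hn) (lt_irrefl _)

theorem eq_of_dvd_of_near {s t : ℕ} (hs : M ∣ s) (ht : M ∣ t) (h1 : s < t + M) (h2 : t < s + M) :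
    s = t := by
  obtain ⟨i, rfl⟩ := hs
  obtain ⟨j, rfl⟩ := ht
  have h3 : M * i < M * (j + 1) := by rw [mul_add]; omega
  have h4 : M * j < M * (i + 1) := by rw [mul_add]; omega
  have h5 := lt_of_mul_lt_mul_left h3 (Nat.zero_le _)
  have h6 := lt_of_mul_lt_mul_left h4 (Nat.zero_le _)
  congr 1
  omega

open Classical in
theorem exists_treeLike_base (hn : 2 ≤ n) (hM : n ≤ M) (T : ℕ) :
    ∃ par mate r, TreeLike (base n M T) par mate r := by
  refine ⟨fun u => if u.1 = 0 then none else some ⟨u.1 - 1, by omega⟩,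
    fun u => if h : M ∣ u.1 then (if h : u.1 + n - 1 < T then some ⟨u.1 + n - 1, h⟩ else none)
      else some ⟨u.1 + 1 - n, by omega⟩, fun u => u.1, ?_, ?_⟩
  · rintro u v h
    split_ifs at h with h1
    simp only [Option.some.injEq] at h
    rw [← h]
    exact Nat.sub_lt (Nat.pos_of_ne_zero h1) one_pos
  · rintro ⟨u, hu⟩ ⟨v, hv⟩ h
    rw [base_adj hn] at h
    rcases h with (h | ⟨h1, h2⟩) | (h | ⟨h1, h2⟩) <;> simp only at *
    · right; left
      rw [if_neg (by omega)]
      simp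
      omega
    · right; right
      rw [dif_pos h1, dif_pos (by omega)]
      simp
      omega
    · left
      rw [if_neg (by omega)]
      simp
      omega
    · right; right
      rw [dif_neg]
      · simp
        omega
      · intro h3
        have := eq_of_dvd_of_near h1 h3 (by omega) (by omega)
        omega

/-- The graph obtained from `base n M T` by attaching a leaf to every vertex and then `ℓ` leaves to
all the vertices obtained. -/
abbrev cactus (n M T ℓ : ℕ) : SimpleGraph ((Fin T × Option Unit) × Option (Fin ℓ)) :=
  leafy (leafy (base n M T) Unit) (Fin ℓ)

theorem aliceWins_cactus (hn : 2 ≤ n) (hM : n ≤ M) :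
    AliceWins (cactus n M T ℓ) .alice (fun _ => (none : Option (Fin 5))) := by
  obtain ⟨par, mate, r, h⟩ := exists_treeLike_base hn hM T
  exact h.leafy.leafy.aliceWins

/-- The inclusion of the base. -/
abbrev core (ℓ : ℕ) {T : ℕ} (p : Fin T) : (Fin T × Option Unit) × Option (Fin ℓ) :=
  ((p, none), none)

/-- The part of the base between `s` and `s + n`. -/
def block (n T ℓ s : ℕ) : Set ((Fin T × Option Unit) × Option (Fin ℓ)) :=
  {v | ∃ p : Fin T, v = core ℓ p ∧ s ≤ p ∧ p < s + n}

theorem cactus_adj_core (hn : 2 ≤ n) {p q : Fin T} :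
    (cactus n M T ℓ).Adj (core ℓ p) (core ℓ q) ↔ baseLink n M p q ∨ baseLink n M q p := by
  rw [← base_adj hn]
  simp [leafy]

section
variable {u : (Fin T × Option Unit) × Option (Fin ℓ)} {c : (cactus n M T ℓ).Walk u u}

theorem snd_eq_none_of_mem_cycle (hc : c.IsCycle) {x y : (Fin T × Option Unit) × Option (Fin ℓ)}
    (h : s(x, y) ∈ c.edges) : x.2 = none := by
  by_contra hx
  have key : ∀ z, (cactus n M T ℓ).Adj x z → z = (x.1, none) := by
    rintro z (h1 | ⟨h1, h2⟩)
    · exact absurd h1.1 hx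
    · refine Prod.ext h1.symm ?_
      simp only
      tauto
  have hy := key y (c.adj_of_mem_edges h)
  obtain ⟨a, ha, b, hb, h1, h2⟩ := exists_other_crossing hc h (S := {x}) rfl
    (fun h' => (c.adj_of_mem_edges h).ne h'.symm)
  rw [Set.mem_singleton_iff] at ha
  subst ha
  exact h2 (by rw [hy, key b (c.adj_of_mem_edges h1)])

theorem exists_eq_core_of_mem_cycle (hc : c.IsCycle)
    {x y : (Fin T × Option Unit) × Option (Fin ℓ)} (h : s(x, y) ∈ c.edges) :
    ∃ p, x = core ℓ p := by
  obtain ⟨⟨p, i⟩, j⟩ := x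
  have hx := snd_eq_none_of_mem_cycle hc h
  simp only at hx
  subst hx
  rcases i with _ | i
  · exact ⟨p, rfl⟩
  exfalso
  have key : ∀ z, s(((p, some i), none), z) ∈ c.edges → z = core ℓ p := by
    rintro ⟨⟨q, k⟩, m⟩ hz
    have h0 := snd_eq_none_of_mem_cycle hc (x := ((q, k), m)) (y := ((p, some i), none)) (by
      rwa [Sym2.eq_swap])
    have hz := c.adj_of_mem_edges hz
    simp only at h0
    subst h0
    simp [leafy] at hz
    rw [hz.1, hz.2]
  obtain ⟨a, ha, b, hb, h1, h2⟩ := exists_other_crossing hc h (S := {((p, some i), none)}) rfl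
    (fun h' => (c.adj_of_mem_edges h).ne h'.symm)
  rw [Set.mem_singleton_iff] at ha
  subst ha
  exact h2 (by rw [key y h, key b h1])

theorem exists_crossing_baseLink (hn : 2 ≤ n) (hc : c.IsCycle) {p q : Fin T}
    (h : s(core ℓ p, core ℓ q) ∈ c.edges) {j : ℕ} (hp : p ≤ j) (hq : j < q) :
    ∃ p' q' : Fin T, p' ≤ j ∧ j < q' ∧ baseLink n M p' q' ∧ s(core ℓ p', core ℓ q') ∈ c.edges ∧
      (p', q') ≠ (p, q) := by
  obtain ⟨a, ha, b, hb, h1, h2⟩ := exists_other_crossing hc h (S := {v | v.1.1 ≤ j}) hp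
    (by simpa using hq)
  obtain ⟨p', rfl⟩ := exists_eq_core_of_mem_cycle hc h1
  obtain ⟨q', rfl⟩ := exists_eq_core_of_mem_cycle hc (by rwa [Sym2.eq_swap] at h1)
  simp only [Set.mem_ofPred_eq, not_le] at ha hb
  refine ⟨p', q', ha, hb, ?_, h1, fun h' => h2 ?_⟩
  · refine ((cactus_adj_core hn).1 (c.adj_of_mem_edges h1)).resolve_right fun h' => ?_
    have := h'.lt hn
    omega
  · simp only [Prod.mk.injEq] at h'
    rw [h'.1, h'.2]

/-- A cycle through an edge of the base uses a chord over that edge. -/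
theorem exists_chord_of_mem_cycle (hn : 2 ≤ n) (hc : c.IsCycle) {p q : Fin T}
    (h : s(core ℓ p, core ℓ q) ∈ c.edges) (hpq : baseLink n M p q) :
    ∃ a b : Fin T, M ∣ a.1 ∧ b.1 + 1 = a + n ∧ a ≤ p ∧ q ≤ b ∧ s(core ℓ a, core ℓ b) ∈ c.edges := by
  rcases hpq with h1 | ⟨h1, h2⟩
  · obtain ⟨a, b, ha, hb, h3 | ⟨h3, h4⟩, h5, h6⟩ :=
      exists_crossing_baseLink hn hc h (j := p) le_rfl (by omega)
    · refine absurd ?_ h6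
      rw [Prod.mk.injEq, Fin.ext_iff, Fin.ext_iff]
      omega
    · exact ⟨a, b, h3, h4, ha, by rw [Fin.le_def]; omega, h5⟩
  · exact ⟨p, q, h1, h2, le_rfl, le_rfl, h⟩

/-- A cycle through a chord uses all the edges of the base below that chord. -/
theorem mem_cycle_of_chord (hn : 2 ≤ n) (hM : n ≤ M) (hc : c.IsCycle) {a b p q : Fin T}
    (h1 : M ∣ a.1) (h2 : b.1 + 1 = a + n) (h : s(core ℓ a, core ℓ b) ∈ c.edges)
    (hpq : baseLink n M p q) (hp : a ≤ p) (hq : q ≤ b) : s(core ℓ p, core ℓ q) ∈ c.edges := by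
  rw [Fin.le_def] at hp hq
  have hlt := hpq.lt hn
  rcases hpq with h3 | ⟨h3, h4⟩
  · obtain ⟨p', q', h5, h6, h7 | ⟨h7, h8⟩, h9, h10⟩ :=
      exists_crossing_baseLink hn hc h (j := p) hp (by omega)
    · obtain rfl : p = p' := Fin.ext (by omega)
      obtain rfl : q = q' := Fin.ext (by omega)
      exact h9
    · have := eq_of_dvd_of_near h1 h7 (by omega) (by omega)
      refine absurd ?_ h10
      rw [Prod.mk.injEq, Fin.ext_iff, Fin.ext_iff]
      omega
  · obtain rfl : a = p := Fin.ext (eq_of_dvd_of_near h1 h3 (by omega) (by omega))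
    obtain rfl : b = q := Fin.ext (by omega)
    exact h

/-- Every cycle is a block. -/
theorem exists_block_of_isCycle (hn : 2 ≤ n) (hM : n ≤ M) (hc : c.IsCycle) :
    ∃ s, M ∣ s ∧ s + n ≤ T ∧ u ∈ block n T ℓ s ∧ (∀ v ∈ block n T ℓ s, v ∈ c.support) ∧
      ∀ e, e ∈ c.edges ↔ e ∈ (cactus n M T ℓ).edgeSet ∧ ∀ v ∈ e, v ∈ block n T ℓ s := by
  have chord : ∀ p q : Fin T, s(core ℓ p, core ℓ q) ∈ c.edges →
      ∃ a b : Fin T, M ∣ a.1 ∧ b.1 + 1 = a + n ∧ a ≤ p ∧ p ≤ b ∧ a ≤ q ∧ q ≤ b ∧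
        s(core ℓ a, core ℓ b) ∈ c.edges := by
    intro p q h
    rcases (cactus_adj_core hn).1 (c.adj_of_mem_edges h) with h1 | h1
    · obtain ⟨a, b, h2, h3, h4, h5, h6⟩ := exists_chord_of_mem_cycle hn hc h h1
      have := h1.lt hn
      exact ⟨a, b, h2, h3, h4, by omega, by omega, h5, h6⟩
    · rw [Sym2.eq_swap] at h
      obtain ⟨a, b, h2, h3, h4, h5, h6⟩ := exists_chord_of_mem_cycle hn hc h h1
      have := h1.lt hn
      exact ⟨a, b, h2, h3, by omega, h5, h4, by omega, h6⟩
  have first : ∃ p q : Fin T, u = core ℓ p ∧ s(core ℓ p, core ℓ q) ∈ c.edges := by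
    obtain ⟨v, hv⟩ : ∃ v, s(u, v) ∈ c.edges := by
      cases c with
      | nil => exact absurd hc (by simp)
      | @cons _ v _ h p => exact ⟨v, by simp⟩
    obtain ⟨p, rfl⟩ := exists_eq_core_of_mem_cycle hc hv
    obtain ⟨q, rfl⟩ := exists_eq_core_of_mem_cycle hc (by rwa [Sym2.eq_swap] at hv)
    exact ⟨p, q, rfl, hv⟩
  obtain ⟨p, q, hu, hpq⟩ := first
  obtain ⟨a, b, h1, h2, h3, h4, h5, h6, hab⟩ := chord p q hpq
  have hmem : ∀ x y, s(x, y) ∈ c.edges → x ∈ block n T ℓ a → y ∈ block n T ℓ a := by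
    rintro x y hxy ⟨p', rfl, h7, h8⟩
    obtain ⟨q', rfl⟩ := exists_eq_core_of_mem_cycle hc (by rwa [Sym2.eq_swap] at hxy)
    obtain ⟨a', b', h9, h10, h11, h12, h13, h14, -⟩ := chord p' q' hxy
    rw [Fin.le_def] at h11 h12 h13 h14
    have := eq_of_dvd_of_near h1 h9 (by omega) (by omega)
    exact ⟨q', rfl, by omega, by omega⟩
  have hub : u ∈ block n T ℓ a := ⟨p, hu, h3, by rw [Fin.le_def] at h4; omega⟩
  have hsupp := forall_mem_support_of_edges c hub hmem
  have path : ∀ p q : Fin T, p.1 + 1 = q → a ≤ p → q ≤ b → s(core ℓ p, core ℓ q) ∈ c.edges :=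
    fun p q h7 h8 h9 => mem_cycle_of_chord hn hM hc h1 h2 hab (.inl h7) h8 h9
  refine ⟨a, h1, by omega, hub, ?_, fun e => ⟨fun he => ⟨c.edges_subset_edgeSet he, fun v hv =>
    hsupp v (c.mem_support_of_mem_edges he hv)⟩, ?_⟩⟩
  · rintro v ⟨j, rfl, h7, h8⟩
    by_cases hj : j = b
    · subst hj
      exact c.snd_mem_support_of_mem_edges hab
    · have h9 : j.1 ≠ b := fun h => hj (Fin.ext h)
      exact c.fst_mem_support_of_mem_edges (path j ⟨j + 1, by omega⟩ rfl h7 (by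
        rw [Fin.le_def]; simp only; omega))
  · induction e with | h x y
    rintro ⟨h7, h8⟩
    obtain ⟨p', rfl, h9, h10⟩ := h8 x (by simp)
    obtain ⟨q', rfl, h11, h12⟩ := h8 y (by simp)
    rcases (cactus_adj_core hn).1 h7 with h13 | h13
    · exact mem_cycle_of_chord hn hM hc h1 h2 hab h13 h9 (by rw [Fin.le_def]; omega)
    · rw [Sym2.eq_swap]
      exact mem_cycle_of_chord hn hM hc h1 h2 hab h13 h11 (by rw [Fin.le_def]; omega)

end

theorem isCactus_cactus (hn : 2 ≤ n) (hM : n ≤ M) : IsCactus (cactus n M T ℓ) := by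
  intro u v c₁ c₂ h₁ h₂ e he₁ he₂ e'
  obtain ⟨s, hs, -, -, -, h3⟩ := exists_block_of_isCycle hn hM h₁
  obtain ⟨t, ht, -, -, -, h4⟩ := exists_block_of_isCycle hn hM h₂
  have : s = t := by
    induction e with | h x y
    obtain ⟨p, h5, h6, h7⟩ := ((h3 _).1 he₁).2 x (by simp)
    obtain ⟨q, h8, h9, h10⟩ := ((h4 _).1 he₂).2 x (by simp)
    rw [h5] at h8
    have h11 : p = q := by simpa using h8
    subst h11
    exact eq_of_dvd_of_near hs ht (by omega) (by omega)
  subst this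
  rw [h3, h4]

theorem le_egirth_cactus (hn : 2 ≤ n) (hM : n ≤ M) {k : ℕ} (hk : k + 1 ≤ n) :
    (k : ℕ∞) ≤ (cactus n M T ℓ).egirth := by
  rw [SimpleGraph.le_egirth]
  intro u c hc
  obtain ⟨s, hs, hT, -, h, -⟩ := exists_block_of_isCycle hn hM hc
  have h1 : (Finset.univ.image fun i : Fin n => core ℓ (⟨s + i, by omega⟩ : Fin T)).card = n := by
    rw [Finset.card_image_of_injective]
    · simp
    · intro i j hij
      simp at hij
      exact Fin.ext hij
  have h2 : (Finset.univ.image fun i : Fin n => core ℓ (⟨s + i, by omega⟩ : Fin T)) ⊆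
      c.support.toFinset := by
    intro v hv
    obtain ⟨i, -, rfl⟩ := Finset.mem_image.1 hv
    rw [List.mem_toFinset]
    exact h _ ⟨_, rfl, by simp, by simp⟩
  have h3 := (Finset.card_le_card h2).trans (List.toFinset_card_le _)
  rw [h1, SimpleGraph.Walk.length_support] at h3
  exact_mod_cast (by omega : k ≤ c.length)

theorem le_length_of_block (hn : 2 ≤ n) {L : ℕ} (hM : M = n + L) {s t : ℕ} (hs : M ∣ s)
    (ht : M ∣ t) (hst : s < t) {u v : (Fin T × Option Unit) × Option (Fin ℓ)}
    (hu : u ∈ block n T ℓ s) (hv : v ∈ block n T ℓ t) (P : (cactus n M T ℓ).Walk u v) :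
    L ≤ P.length := by
  have hst' : s + M ≤ t := by
    by_contra! h
    exact hst.ne (eq_of_dvd_of_near hs ht (by omega) h)
  have base : ∀ a b : ℕ, baseLink n M a b → min (max a (s + n)) (s + M) =
      min (max b (s + n)) (s + M) ∨ b = a + 1 := by
    rintro a b (h | ⟨h1, h2⟩)
    · exact Or.inr h.symm
    · left
      rcases lt_trichotomy a s with h | rfl | h
      · omega
      · omega
      · have : s + M ≤ a := by
          by_contra! h'
          exact h.ne (eq_of_dvd_of_near hs h1 (by omega) h')
        omega
  have := walk_potential_le (φ := fun x : (Fin T × Option Unit) × Option (Fin ℓ) =>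
    min (max x.1.1.1 (s + n)) (s + M)) (G := cactus n M T ℓ) ?_ P
  · obtain ⟨p, rfl, h1, h2⟩ := hu
    obtain ⟨q, rfl, h3, h4⟩ := hv
    simp only at this
    omega
  · rintro x y (⟨-, -, ⟨-, -, h⟩ | ⟨h, -⟩⟩ | ⟨h, -⟩)
    · rw [base_adj hn] at h
      rcases h with h | h <;> rcases base _ _ h with h' | h' <;> omega
    · simp [h]
    · simp [h]

theorem le_cycleDistance_cactus (hn : 2 ≤ n) {L : ℕ} (hM : M = n + L) :
    (L : ℕ∞) ≤ cycleDistance (cactus n M T ℓ) := by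
  rw [cycleDistance]
  refine le_iInf fun u => le_iInf fun v => le_iInf fun c₁ => le_iInf fun c₂ => le_iInf fun h₁ =>
    le_iInf fun h₂ => le_iInf fun hne => le_iInf fun P => le_iInf fun _ => ?_
  obtain ⟨s, hs, -, hu, -, h3⟩ := exists_block_of_isCycle hn (by omega) h₁
  obtain ⟨t, ht, -, hv, -, h4⟩ := exists_block_of_isCycle hn (by omega) h₂
  have hst : s ≠ t := by
    rintro rfl
    exact hne fun e => by rw [h3, h4]
  norm_cast
  rcases hst.lt_or_gt with h | h
  · exact le_length_of_block hn hM hs ht h hu hv P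
  · simpa using le_length_of_block hn hM ht hs h hv hu P.reverse

/-- An odd block is not 2-colorable. -/
theorem not_colorable_two_cactus (hn : 3 ≤ n) (hodd : n % 2 = 1) (hT : n ≤ T) :
    ¬ (cactus n M T ℓ).Colorable 2 := by
  rintro ⟨C⟩
  have step : ∀ i (hi : i < n), ((C (core ℓ ⟨i, by omega⟩)).1 + i) % 2 =
      (C (core ℓ ⟨0, by omega⟩)).1 % 2 := by
    intro i
    induction i with
    | zero => simp
    | succ i ih =>
      intro hi
      have h1 := ih (by omega)
      have h2 : C (core ℓ ⟨i, by omega⟩) ≠ C (core ℓ ⟨i + 1, by omega⟩) :=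
        C.valid ((cactus_adj_core (by omega)).2 (.inl (.inl rfl)))
      rw [Ne, Fin.ext_iff] at h2
      omega
  have h1 := step (n - 1) (by omega)
  have h2 : C (core ℓ ⟨0, by omega⟩) ≠ C (core ℓ ⟨n - 1, by omega⟩) :=
    C.valid ((cactus_adj_core (by omega)).2 (.inl (.inr ⟨by simp, by simp; omega⟩)))
  rw [Ne, Fin.ext_iff] at h2
  omega

end

section
variable {X : Type} {R : X → X → Prop}

/-- There is a walk with `m` steps from `a` to `b` along the relation `R`. -/
def Route (R : X → X → Prop) (a b : X) (m : ℕ) : Prop :=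
  ∃ l : List X, (a :: l).IsChain R ∧ l.getLastD a = b ∧ l.length = m

theorem isChain_cons_append_of_getLastD {a : X} {l e : List X} (h : (a :: l).IsChain R)
    (h' : (l.getLastD a :: e).IsChain R) : (a :: (l ++ e)).IsChain R := by
  induction l generalizing a with
  | nil => exact h'
  | cons b l ih =>
    rw [List.isChain_cons_cons] at h
    rw [List.getLastD_cons] at h'
    exact List.isChain_cons_cons.2 ⟨h.1, ih h.2 h'⟩

theorem getLastD_append_eq (l e : List X) (a : X) :
    (l ++ e).getLastD a = e.getLastD (l.getLastD a) := by
  induction l generalizing a with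
  | nil => rfl
  | cons b l ih => rw [List.cons_append, List.getLastD_cons, List.getLastD_cons, ih]

theorem Route.trans {a b c : X} {m m' : ℕ} (h : Route R a b m) (h' : Route R b c m') :
    Route R a c (m + m') := by
  obtain ⟨l, h1, rfl, rfl⟩ := h
  obtain ⟨l', h2, rfl, rfl⟩ := h'
  exact ⟨l ++ l', isChain_cons_append_of_getLastD h1 h2, getLastD_append_eq _ _ _,
    List.length_append⟩

theorem Route.single {a b : X} (h : R a b) : Route R a b 1 :=
  ⟨[b], by simpa using h, rfl, rfl⟩

theorem Route.flip {a b : X} {m : ℕ} (h : Route R a b m) : Route (flip R) b a m := by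
  obtain ⟨l, h1, rfl, rfl⟩ := h
  induction l generalizing a with
  | nil => exact ⟨[], by simp, rfl, rfl⟩
  | cons x l ih =>
    rw [List.isChain_cons_cons] at h1
    rw [List.getLastD_cons]
    exact (ih h1.2).trans (Route.single h1.1)

theorem nodup_and_between_of_isChain {r : X → X → Prop} [IsTrans X r] [Std.Irrefl r] {a : X}
    {l : List X} (h : (a :: l).IsChain r) :
    l.Nodup ∧ ∀ y ∈ l, r a y ∧ (y = l.getLastD a ∨ r y (l.getLastD a)) := by
  induction l generalizing a with
  | nil => simp
  | cons b l ih =>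
    rw [List.isChain_cons_cons] at h
    obtain ⟨h1, h2⟩ := ih h.2
    rw [List.getLastD_cons]
    refine ⟨List.nodup_cons.2 ⟨fun hb => irrefl_of r b (h2 b hb).1, h1⟩, fun y hy => ?_⟩
    rcases List.mem_cons.1 hy with rfl | hy
    · refine ⟨h.1, ?_⟩
      rcases l.eq_nil_or_concat with rfl | ⟨l', z, rfl⟩
      · simp
      · right
        have := (h2 z (by simp)).1
        simpa using this
    · exact ⟨_root_.trans h.1 (h2 y hy).1, (h2 y hy).2⟩

end

section
variable {n M T : ℕ}

theorem route_succ (hn : 2 ≤ n) {a b : Fin T} (h : a ≤ b) :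
    Route (fun x y => (base n M T).Adj x y ∧ x < y) a b (b.1 - a.1) := by
  obtain ⟨a, ha⟩ := a
  obtain ⟨b, hb⟩ := b
  rw [Fin.mk_le_mk] at h
  induction b, h using Nat.le_induction with
  | base => exact ⟨[], by simp, rfl, by simp⟩
  | succ b hab ih =>
    have := (ih (by omega)).trans (Route.single
      (R := fun x y => (base n M T).Adj x y ∧ x < y) (b := ⟨b + 1, hb⟩)
      ⟨(base_adj hn).2 (.inl (.inl rfl)), by simp⟩)
    simpa [Nat.succ_sub hab] using this

/-- Over an odd block there are routes of both parities. -/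
theorem exists_route_parity (hn : 2 ≤ n) (hodd : n % 2 = 1) {a b : Fin T} {j : ℕ} (hj : M ∣ j)
    (ha : a ≤ j) (hb : j + n ≤ b + 1) (o : Bool) :
    ∃ m, Route (fun x y => (base n M T).Adj x y ∧ x < y) a b m ∧ (m % 2 = 1 ↔ o = true) := by
  have h1 := route_succ (M := M) hn (a := a) (b := b) (by rw [Fin.le_def]; omega)
  have h2 := ((route_succ (M := M) hn (a := a) (b := ⟨j, by omega⟩) ha).trans (Route.single
    (R := fun x y => (base n M T).Adj x y ∧ x < y) (b := ⟨j + n - 1, by omega⟩)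
    ⟨(base_adj hn).2 (.inl (.inr ⟨hj, by simp; omega⟩)), by rw [Fin.lt_def]; simp; omega⟩)).trans
    (route_succ (M := M) hn (b := b) (by rw [Fin.le_def]; simp; omega))
  simp only at h2
  by_cases h : (b.1 - a.1) % 2 = 1 ↔ o = true
  · exact ⟨_, h1, h⟩
  · refine ⟨_, h2, ?_⟩
    cases o <;> simp at h ⊢ <;> omega

variable {ℓ : ℕ}

/-- The uncoloured vertices of `W`. -/
def uncol {W : Type} (c : W × Option (Fin ℓ) → Option (Fin 4)) : Set W := {w | c (w, none) = none}

/-- The colours adjacent to the vertices of `W`. -/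
def phiNat {W : Type} (H : SimpleGraph W) (c : W × Option (Fin ℓ) → Option (Fin 4)) (w : W) :
    Set ℕ := {a | ∃ h : a < 4, (⟨a, h⟩ : Fin 4) ∈ Phi (leafy H (Fin ℓ)) c (w, none)}

theorem mem_phiNat {W : Type} {H : SimpleGraph W} {c : W × Option (Fin ℓ) → Option (Fin 4)} {w : W}
    {y : W × Option (Fin ℓ)} {a : Fin 4} (h : (leafy H (Fin ℓ)).Adj (w, none) y)
    (hy : c y = some a) : a.1 ∈ phiNat H c w := ⟨a.2, y, h, hy⟩

variable {c : (Fin T × Option Unit) × Option (Fin ℓ) → Option (Fin 4)}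

/-- A coloured vertex above `p` forbids a colour at the end of a path going from a neighbour of
`p` to the vertices above `p`. -/
theorem exists_hot_end {p p' : Fin T} (hadj : (base n M T).Adj p' p)
    (hp : ∃ i j, c ((p, i), j) ≠ none) :
    ∃ x < 4, ∃ e : List (Fin T × Option Unit),
      ((p', none) :: e).IsChain (leafy (base n M T) Unit).Adj ∧ e.Nodup ∧
      (∀ y ∈ e, y ∈ uncol c ∧ y.1 = p) ∧
      x ∈ phiNat (leafy (base n M T) Unit) c (e.getLastD (p', none)) := by
  have hside : (leafy (base n M T) Unit).Adj (p, none) (p, some ()) := Or.inr ⟨rfl, by simp⟩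
  have hcore : (leafy (base n M T) Unit).Adj (p', none) (p, none) := Or.inl ⟨rfl, rfl, hadj⟩
  have hleaf : ∀ w j, (leafy (leafy (base n M T) Unit) (Fin ℓ)).Adj (w, none) (w, some j) :=
    fun w j => Or.inr ⟨rfl, by simp⟩
  rcases h0 : c ((p, none), none) with _ | x
  · by_cases h1 : ∃ y, (leafy (leafy (base n M T) Unit) (Fin ℓ)).Adj ((p, none), none) y ∧
        c y ≠ none
    · obtain ⟨y, hy, hc⟩ := h1
      obtain ⟨x, hx⟩ := Option.ne_none_iff_exists'.1 hc
      exact ⟨x, x.2, [(p, none)], by simpa using hcore, by simp, by simp [uncol, h0],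
        mem_phiNat hy hx⟩
    · push Not at h1
      obtain ⟨i, j, hij⟩ := hp
      rcases i with _ | i
      · rcases j with _ | j
        · exact absurd h0 hij
        · exact absurd (h1 _ (hleaf _ j)) hij
      · have h2 : c ((p, some ()), none) = none := h1 _ (Or.inl ⟨rfl, rfl, hside⟩)
        rcases j with _ | j
        · exact absurd h2 hij
        · obtain ⟨x, hx⟩ := Option.ne_none_iff_exists'.1 hij
          refine ⟨x, x.2, [(p, none), (p, some ())], ?_, by simp, ?_, mem_phiNat (hleaf _ j) hx⟩
          · simpa using ⟨hcore, hside⟩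
          · simpa using ⟨h0, h2⟩
  · have hadj' : (leafy (leafy (base n M T) Unit) (Fin ℓ)).Adj ((p', none), none)
        ((p, none), none) := Or.inl ⟨rfl, rfl, hcore⟩
    exact ⟨x, x.2, [], by simp, by simp, by simp, mem_phiNat hadj' h0⟩

/-- A tail of both parities obtained from routes in the base. -/
theorem tailOK_both {r : Fin T → Fin T → Prop} [IsTrans _ r] [Std.Irrefl r] {a p' p : Fin T}
    (hadj : (base n M T).Adj p' p) (hr : r p' p) (hap : r a p')
    (hroute : ∀ o : Bool, ∃ m, Route (fun x y => (base n M T).Adj x y ∧ r x y) a p' m ∧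
      (m % 2 = 1 ↔ o = true))
    (hp : ∃ i j, c ((p, i), j) ≠ none) (hclean : ∀ y, r a y → r y p → (y, none) ∈ uncol c)
    {ρ : Fin T × Option Unit → ℕ} {e : ℕ} (hρ : ∀ y i, r a y → ρ (y, i) = e) :
    TailOK (leafy (base n M T) Unit) (uncol c) (phiNat (leafy (base n M T) Unit) c) ρ (a, none) e
      .both := by
  obtain ⟨x, hx, E, h1, h2, h3, h4⟩ := exists_hot_end hadj hp
  refine ⟨x, hx, fun o => ?_⟩
  obtain ⟨m, ⟨l, g1, g2, rfl⟩, g3⟩ := hroute (xor o (decide (E.length % 2 = 1)))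
  obtain ⟨k1, k2⟩ := nodup_and_between_of_isChain (g1.imp fun _ _ h => h.2)
  rw [g2] at k2
  have hlast : (l.map fun y => (y, (none : Option Unit))).getLastD (a, none) = (p', none) := by
    rw [← g2]
    rcases l.eq_nil_or_concat with rfl | ⟨l', z, rfl⟩ <;> simp
  have hb : ∀ y ∈ l, r a y ∧ r y p := fun y hy => ⟨(k2 y hy).1, (k2 y hy).2.elim
    (fun h => h ▸ hr) fun h => _root_.trans h hr⟩
  refine ⟨l.map (·, none) ++ E, ?_, ?_, ?_, ?_, ?_⟩
  · refine isChain_cons_append_of_getLastD ?_ (by rwa [hlast])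
    rw [← List.map_cons (f := fun y => (y, (none : Option Unit))), List.isChain_map]
    exact g1.imp fun _ _ h => Or.inl ⟨rfl, rfl, h.1⟩
  · refine List.nodup_append.2 ⟨k1.map fun _ _ h => by simpa using h, h2, ?_⟩
    rintro y hy z hz rfl
    obtain ⟨w, hw, rfl⟩ := List.mem_map.1 hy
    have := (h3 _ hz).2
    simp only at this
    subst this
    exact irrefl_of r _ (hb _ hw).2
  · intro y hy
    rcases List.mem_append.1 hy with hy | hy
    · obtain ⟨w, hw, rfl⟩ := List.mem_map.1 hy
      exact ⟨hclean w (hb w hw).1 (hb w hw).2, hρ _ _ (hb w hw).1⟩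
    · obtain ⟨q, i⟩ := y
      have := (h3 _ hy).2
      simp only at this
      subst this
      exact ⟨(h3 _ hy).1, hρ _ _ (_root_.trans hap hr)⟩
  · rw [getLastD_append_eq, hlast]
    exact h4
  · rw [List.length_append, List.length_map]
    rcases o with _ | _ <;> by_cases hE : E.length % 2 = 1 <;> simp [hE] at g3 ⊢ <;> omega

end

section
variable {n M T ℓ : ℕ}

/-- The names of the vertices around a block. -/
def blockName (p₀ p₁ p₂ p₃ : Fin T) : ℕ → Fin T × Option Unit
  | 0 => (p₀, none)
  | 1 => (p₁, none)
  | 2 => (p₂, none)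
  | 3 => (p₃, none)
  | 4 => (p₀, some ())
  | 5 => (p₁, some ())
  | 6 => (p₂, some ())
  | 7 => (p₃, some ())
  | _ => (p₀, none)

/-- The labels of the vertices around the block of length `n` starting at `B`. -/
def blockLabel (n B : ℕ) (y : Fin T × Option Unit) : ℕ :=
  if y.1.1 + 1 < B then 10
  else if B + n < y.1.1 then 11
  else if B < y.1.1 ∧ y.1.1 + 1 < B + n then (if y.2 = none then 16 else 17)
  else (if y.2 = none then 0 else 4) +
    (if y.1.1 + 1 = B then 2 else if y.1.1 = B then 0 else if y.1.1 + 1 = B + n then 1 else 3)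

theorem blockName_adj (hn : 3 ≤ n) {p₀ p₁ p₂ p₃ : Fin T} (h₀ : M ∣ p₀) (h₁ : p₁.1 + 1 = p₀ + n)
    (h₂ : p₂.1 + 1 = p₀) (h₃ : p₃.1 = p₀ + n) (i j : ℕ) (h : namedAdj i j = true) :
    (leafy (base n M T) Unit).Adj (blockName p₀ p₁ p₂ p₃ i) (blockName p₀ p₁ p₂ p₃ j) := by
  have key : ∀ i j, (i = 0 ∧ j = 1) ∨ (i < 2 ∧ j = i + 2) ∨ (i < 4 ∧ j = i + 4) →
      (leafy (base n M T) Unit).Adj (blockName p₀ p₁ p₂ p₃ i) (blockName p₀ p₁ p₂ p₃ j) := by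
    rintro i j (⟨rfl, rfl⟩ | ⟨hi, rfl⟩ | ⟨hi, rfl⟩)
    · exact Or.inl ⟨rfl, rfl, (base_adj (by omega)).2 (.inl (.inr ⟨h₀, h₁⟩))⟩
    · interval_cases i
      · exact Or.inl ⟨rfl, rfl, (base_adj (by omega)).2 (.inr (.inl h₂))⟩
      · exact Or.inl ⟨rfl, rfl, (base_adj (by omega)).2 (.inl (.inl (h₁.trans h₃.symm)))⟩
    · interval_cases i <;> exact Or.inr ⟨rfl, by simp [blockName]⟩
  simp only [namedAdj, Bool.or_eq_true, Bool.and_eq_true, beq_iff_eq, decide_eq_true_eq] at h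
  rcases h with ((((h | h) | h) | h) | h) | h
  · exact key i j (.inl h)
  · exact (key j i (.inl h.symm)).symm
  · exact key i j (.inr (.inl h))
  · exact (key j i (.inr (.inl h))).symm
  · exact key i j (.inr (.inr h))
  · exact (key j i (.inr (.inr h))).symm

variable {c : (Fin T × Option Unit) × Option (Fin ℓ) → Option (Fin 4)}

/-- Bob wins with four colours if there is a long uncoloured interval of the base between two
vertices above which there are coloured vertices. -/
theorem bobForces_of_gap (hn : 3 ≤ n) (hodd : n % 2 = 1) (hM : n < M) {s t : Fin T}
    (hst : s + 4 * M ≤ t.1) (hs : ∃ i j, c ((s, i), j) ≠ none) (ht : ∃ i j, c ((t, i), j) ≠ none)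
    (hclean : ∀ p, s < p → p < t → ∀ i j, c ((p, i), j) = none) :
    BobForces 4 (leafy (base n M T) Unit)
      (startCert.depth + (2 * Nat.card (Fin T × Option Unit) + 1)) (uncol c)
      (phiNat (leafy (base n M T) Unit) c) := by
  obtain ⟨j, hj, hj1, hj2⟩ : ∃ j, M ∣ j ∧ s < j ∧ j ≤ s + M :=
    ⟨M * (s / M + 1), dvd_mul_right _ _, Nat.lt_mul_div_succ _ (by omega), by
      have := Nat.mul_div_le s.1 M
      rw [mul_add]
      omega⟩
  obtain ⟨B, hB⟩ : ∃ B, B = j + M := ⟨_, rfl⟩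
  have hMB : M ∣ B := hB ▸ Nat.dvd_add_self_right.2 hj
  have htT := t.2
  obtain ⟨p₀, h₀⟩ : ∃ p : Fin T, p.1 = B := ⟨⟨B, by omega⟩, rfl⟩
  obtain ⟨p₁, h₁⟩ : ∃ p : Fin T, p.1 + 1 = B + n := ⟨⟨B + n - 1, by omega⟩, by simp; omega⟩
  obtain ⟨p₂, h₂⟩ : ∃ p : Fin T, p.1 + 1 = B := ⟨⟨B - 1, by omega⟩, by simp; omega⟩
  obtain ⟨p₃, h₃⟩ : ∃ p : Fin T, p.1 = B + n := ⟨⟨B + n, by omega⟩, rfl⟩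
  obtain ⟨s', hs'⟩ : ∃ p : Fin T, p.1 = s + 1 := ⟨⟨s + 1, by omega⟩, rfl⟩
  obtain ⟨t', ht'⟩ : ∃ p : Fin T, p.1 + 1 = t := ⟨⟨t - 1, by omega⟩, by simp; omega⟩
  have hcl : ∀ p : Fin T, s.1 < p → p.1 < t → ∀ i, (p, i) ∈ uncol c := fun p h h' i =>
    hclean p h h' i none
  have hname : ∀ i < 8, blockName p₀ p₁ p₂ p₃ i ∈ uncol c ∧
      blockLabel n B (blockName p₀ p₁ p₂ p₃ i) = i := by
    intro i hi
    interval_cases i <;> refine ⟨hcl _ (by omega) (by omega) _, ?_⟩ <;>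
      simp only [blockName, blockLabel] <;> split_ifs <;> first | omega | simp_all
  have h : Realize (leafy (base n M T) Unit) (uncol c) (phiNat (leafy (base n M T) Unit) c)
      (blockName p₀ p₁ p₂ p₃) (blockLabel n B) startPattern := by
    refine ⟨fun i hi => ?_, ?_, fun i a _ h => ?_, fun i _ => ?_, fun _ _ _ => ?_⟩
    · have hi : i < 8 := by simpa [startPattern] using hi
      exact ⟨hi, hname i hi⟩
    · rintro ⟨p, i⟩ - hy
      have e₀ : p.1 = B → p = p₀ := fun h => Fin.ext (by omega)
      have e₁ : p.1 + 1 = B + n → p = p₁ := fun h => Fin.ext (by omega)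
      have e₂ : p.1 + 1 = B → p = p₂ := fun h => Fin.ext (by omega)
      have e₃ : p.1 = B + n → p = p₃ := fun h => Fin.ext (by omega)
      have : p = p₀ ∨ p = p₁ ∨ p = p₂ ∨ p = p₃ := by
        by_contra! hc
        have f₀ : p.1 ≠ B := fun h => hc.1 (e₀ h)
        have f₁ : p.1 + 1 ≠ B + n := fun h => hc.2.1 (e₁ h)
        have f₂ : p.1 + 1 ≠ B := fun h => hc.2.2.1 (e₂ h)
        have f₃ : p.1 ≠ B + n := fun h => hc.2.2.2 (e₃ h)
        revert hy
        simp only [blockLabel]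
        split_ifs <;> omega
      obtain ⟨k, hk, hk'⟩ : ∃ k < 8, (p, i) = blockName p₀ p₁ p₂ p₃ k := by
        rcases i with _ | ⟨⟨⟩⟩ <;> rcases this with rfl | rfl | rfl | rfl
        exacts [⟨0, by simp, rfl⟩, ⟨1, by simp, rfl⟩, ⟨2, by simp, rfl⟩, ⟨3, by simp, rfl⟩,
          ⟨4, by simp, rfl⟩, ⟨5, by simp, rfl⟩, ⟨6, by simp, rfl⟩, ⟨7, by simp, rfl⟩]
      rw [hk', (hname k hk).2]
    · simp [startPattern] at h
    · by_cases hi2 : i = 2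
      · subst hi2
        refine tailOK_both (r := (· > ·)) (p' := s') (p := s)
          ((base_adj (by omega)).2 (.inr (.inl hs'.symm))) ?_ ?_ (fun o => ?_) hs ?_ ?_
        · exact (by omega : s.1 < s')
        · exact (by omega : s'.1 < p₂)
        · obtain ⟨m, h1, h2⟩ := exists_route_parity (M := M) (a := s') (b := p₂) (by omega) hodd hj
            (by omega) (by omega) o
          refine ⟨m, ?_, h2⟩
          obtain ⟨l, g1, g2⟩ := h1.flip
          exact ⟨l, g1.imp fun x y h => ⟨h.1.symm, h.2⟩, g2⟩
        · exact fun y h h' => hcl y h' (by have : y.1 < p₂ := h; omega) _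
        · intro y i h
          have : y.1 < p₂ := h
          simp only [blockLabel]
          rw [if_pos (by omega)]
      · by_cases hi3 : i = 3
        · subst hi3
          refine tailOK_both (r := (· < ·)) (p' := t') (p := t)
            ((base_adj (by omega)).2 (.inl (.inl ht'))) ?_ ?_ (fun o => ?_) ht ?_ ?_
          · exact (by omega : t'.1 < t)
          · exact (by omega : p₃.1 < t')
          · exact exists_route_parity (M := M) (by omega) hodd (Nat.dvd_add_self_right.2 hMB)
              (by omega) (by omega) o
          · exact fun y h h' => hcl y (by have : p₃.1 < y := h; omega) h' _
          · intro y i h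
            have : p₃.1 < y := h
            simp only [blockLabel]
            rw [if_neg (by omega), if_pos (by omega)]
        · have : startPattern.tl i = .none := by
            simp [startPattern, beq_eq_false_iff_ne.2 hi2, beq_eq_false_iff_ne.2 hi3]
          rw [this]
          trivial
    · have hr := route_succ (M := M) (by omega : 2 ≤ n) (a := p₀) (b := p₁) (by
        rw [Fin.le_def]; omega)
      obtain ⟨l, g1, g2, g3⟩ := hr
      rcases l.eq_nil_or_concat with rfl | ⟨l, z, rfl⟩
      · simp at g3
        omega
      simp only [List.concat_eq_append, getLastD_append_eq, List.getLastD_cons, List.getLastD_nil,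
        List.length_append, List.length_cons, List.length_nil] at g1 g2 g3
      subst g2
      obtain ⟨k1, k2⟩ := nodup_and_between_of_isChain (g1.imp fun _ _ h => h.2)
      rw [List.nodup_append] at k1
      refine ⟨l.map (·, none), by rw [List.length_map]; omega, ?_,
        k1.1.map fun _ _ h => by simpa using h, ?_⟩
      · have : blockName p₀ z p₂ p₃ 0 :: (l.map (·, none) ++ [blockName p₀ z p₂ p₃ 1]) =
            (p₀ :: (l ++ [z])).map fun y => (y, (none : Option Unit)) := by simp [blockName]
        rw [this, List.isChain_map]
        exact g1.imp fun _ _ h => Or.inl ⟨rfl, rfl, h.1⟩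
      · intro y hy
        obtain ⟨w, hw, rfl⟩ := List.mem_map.1 hy
        have h3 := k2 w (by simp [hw])
        have h4 : w ≠ z := k1.2.2 w hw z (by simp)
        rw [getLastD_append_eq] at h3
        simp only [h4, List.getLastD_cons, List.getLastD_nil, false_or, Fin.lt_def] at h3
        refine ⟨hcl w (by omega) (by omega) _, ?_⟩
        simp only [blockLabel]
        rw [if_neg (by omega), if_neg (by omega), if_pos (by omega), if_pos trivial]
  exact (h.bobForces (blockName_adj hn (h₀ ▸ hMB) (by omega) (by omega) (by omega)) startCert).1
    startCert_check

/-- Alice does not win with four colours if there are enough blocks and leaves. -/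
theorem not_aliceWins_four (hn : 3 ≤ n) (hodd : n % 2 = 1) (hM : n < M)
    (hℓ : 2 * (startCert.depth + (2 * Nat.card (Fin (16 * M) × Option Unit) + 1)) + 3 ≤ ℓ) :
    ¬ AliceWins (cactus n M (16 * M) ℓ) .alice (fun _ => (none : Option (Fin 4))) := by
  intro hw
  have free := (freeLeaves_none (Fin (16 * M) × Option Unit) ℓ 4).mono hℓ
  obtain ⟨⟨⟨p, i⟩, j⟩, a, hl, hw⟩ :=
    hw.alice_inv (v := ((⟨0, by omega⟩, none), none)) rfl
  have hj0 : 0 < ℓ := by omega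
  obtain ⟨b, hb⟩ : ∃ b : Fin (16 * M),
      (8 * M ≤ p ∧ b.1 = 0) ∨ (p.1 < 8 * M ∧ b.1 + 1 = 16 * M) := by
    by_cases h : 8 * M ≤ p
    · exact ⟨⟨0, by omega⟩, .inl ⟨h, rfl⟩⟩
    · exact ⟨⟨16 * M - 1, by omega⟩, .inr ⟨by omega, by simp; omega⟩⟩
  have hbp : b ≠ p := by
    rintro rfl
    omega
  have hl' : legalMove (cactus n M (16 * M) ℓ)
      (applyMove (fun _ => (none : Option (Fin 4))) ((p, i), j) a)
      ((b, none), some ⟨0, hj0⟩) 0 := by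
    refine ⟨by simp [applyMove, hbp], ?_⟩
    rintro ⟨⟨q, k⟩, m⟩ (h | h)
    · simp at h
    · have : q = b := by
        have := h.1
        simp at this
        exact this.1.symm
      simp [applyMove, this, hbp]
  replace hw := hw.bob_inv hl'
  obtain ⟨⟨⟨q, k⟩, m⟩, a', -, hw⟩ := hw.alice_inv (v := ((b, none), none)) (by
    simp [applyMove, hbp])
  replace free := ((free.applyMove ((p, i), j) a).applyMove ((b, none), some ⟨0, hj0⟩) 0).applyMove
    ((q, k), m) a'
  obtain ⟨c, hc⟩ : ∃ c, c = applyMove (applyMove (applyMove (fun _ => (none : Option (Fin 4)))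
    ((p, i), j) a) ((b, none), some ⟨0, hj0⟩) 0) ((q, k), m) a' := ⟨_, rfl⟩
  rw [← hc] at hw free
  have clean : ∀ x, x ≠ p → x ≠ b → x ≠ q → ∀ i j, c ((x, i), j) = none := by
    intro x h1 h2 h3 i j
    simp [hc, applyMove, h1, h2, h3]
  have mark : ∀ x, x = p ∨ x = b ∨ x = q → ∃ i j, c ((x, i), j) ≠ none := by
    rintro x (rfl | rfl | rfl)
    · refine ⟨i, j, ?_⟩
      simp only [hc, applyMove, Function.update_apply]
      split_ifs <;> simp
    · refine ⟨none, some ⟨0, hj0⟩, ?_⟩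
      simp only [hc, applyMove, Function.update_apply]
      split_ifs <;> simp
    · exact ⟨k, m, by simp [hc, applyMove]⟩
  have win : ∀ s t : Fin (16 * M), (s = p ∨ s = b ∨ s = q) → (t = p ∨ t = b ∨ t = q) →
      s.1 + 4 * M ≤ t → (∀ x, s < x → x < t → x ≠ p ∧ x ≠ b ∧ x ≠ q) → False := by
    intro s t hs ht hst h
    refine not_aliceWins_of_bobForces _ (bobForces_of_gap (c := c) hn hodd hM hst (mark s hs)
      (mark t ht) fun x h1 h2 => clean x (h x h1 h2).1 (h x h1 h2).2.1 (h x h1 h2).2.2) ?_ free hw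
    exact fun v hv => ⟨hv, fun x ⟨_, hx⟩ => hx⟩
  have ne : ∀ x : Fin (16 * M), (x.1 ≠ p ∧ x.1 ≠ b ∧ x.1 ≠ q) → x ≠ p ∧ x ≠ b ∧ x ≠ q :=
    fun x h => ⟨fun h' => h.1 (h' ▸ rfl), fun h' => h.2.1 (h' ▸ rfl), fun h' => h.2.2 (h' ▸ rfl)⟩
  obtain ⟨s, t, hs, ht, hgap, h⟩ : ∃ s t : Fin (16 * M), (s = p ∨ s = b ∨ s = q) ∧
      (t = p ∨ t = b ∨ t = q) ∧ s.1 + 4 * M ≤ t ∧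
      ∀ x : Fin (16 * M), s.1 < x → x.1 < t → x.1 ≠ p ∧ x.1 ≠ b ∧ x.1 ≠ q := by
    have hp := p.2
    have hq := q.2
    by_cases hpb : p.1 < b
    · by_cases h1 : p.1 < q ∧ q.1 < b
      · by_cases h2 : p.1 + 4 * M ≤ q
        · exact ⟨p, q, by simp, by simp, h2, fun x _ _ => by omega⟩
        · exact ⟨q, b, by simp, by simp, by omega, fun x _ _ => by omega⟩
      · exact ⟨p, b, by simp, by simp, by omega, fun x _ _ => by omega⟩
    · by_cases h1 : b.1 < q ∧ q.1 < p
      · by_cases h2 : b.1 + 4 * M ≤ q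
        · exact ⟨b, q, by simp, by simp, h2, fun x _ _ => by omega⟩
        · exact ⟨q, p, by simp, by simp, by omega, fun x _ _ => by omega⟩
      · exact ⟨b, p, by simp, by simp, by omega, fun x _ _ => by omega⟩
  exact win s t hs ht hgap fun x h1 h2 => ne x (h x h1 h2)

end

section
variable {n M T ℓ : ℕ}

theorem exists_base_adj (hT : 2 ≤ T) (hn : 2 ≤ n) (p : Fin T) : ∃ q, (base n M T).Adj p q := by
  by_cases h : p.1 + 1 < T
  · exact ⟨⟨p + 1, h⟩, (base_adj hn).2 (.inl (.inl rfl))⟩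
  · exact ⟨⟨p - 1, by omega⟩, (base_adj hn).2 (.inr (.inl (by simp; omega)))⟩

theorem not_aliceWins_cactus_three (hT : 2 ≤ T) (hn : 2 ≤ n) (hℓ : 7 ≤ ℓ) :
    ¬ AliceWins (cactus n M T ℓ) .alice (fun _ => (none : Option (Fin 3))) := by
  have : Nonempty (Fin T) := ⟨⟨0, by omega⟩⟩
  refine not_aliceWins_three hℓ ?_
  rintro ⟨p, i⟩
  obtain ⟨q, hq⟩ := exists_base_adj (M := M) hT hn p
  rcases i with _ | i
  · exact ⟨(q, none), (q, some ()), Or.inl ⟨rfl, rfl, hq⟩, Or.inr ⟨rfl, by simp⟩, by simp⟩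
  · exact ⟨(p, none), (q, none), Or.inr ⟨rfl, by simp⟩, Or.inl ⟨rfl, rfl, hq⟩, by simp⟩

theorem gameChromaticNumber_cactus (hn : 3 ≤ n) (hodd : n % 2 = 1) (hM : n < M)
    (hℓ : 2 * (startCert.depth + (2 * Nat.card (Fin (16 * M) × Option Unit) + 1)) + 3 ≤ ℓ) :
    gameChromaticNumber (cactus n M (16 * M) ℓ) = 5 := by
  have h5 := aliceWins_cactus (T := 16 * M) (ℓ := ℓ) (by omega : 2 ≤ n) hM.le
  refine le_antisymm (Nat.sInf_le h5) (le_csInf ⟨5, h5⟩ fun q hq => ?_)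
  by_contra! hlt
  have hcard : 0 < Nat.card (Fin (16 * M) × Option Unit) := by
    have : Nonempty (Fin (16 * M)) := ⟨⟨0, by omega⟩⟩
    exact Nat.card_pos
  obtain h | rfl | rfl : q ≤ 2 ∨ q = 3 ∨ q = 4 := by omega
  · obtain ⟨C⟩ := AliceWins.exists_coloring hq fun _ _ _ _ h => by simp at h
    refine not_colorable_two_cactus (n := n) (M := M) (T := 16 * M) (ℓ := ℓ) hn hodd (by omega) ?_
    exact SimpleGraph.Colorable.mono h (by simpa using C.colorable)
  · exact not_aliceWins_cactus_three (by omega) (by omega) (by omega) hq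
  · exact not_aliceWins_four hn hodd hM hℓ hq

end

end GCN

open GCN in
/-- For all positive integers `d` and `k`, there exists a (finite) cactus `CT` with girth at
least `k`, cycle-distance at least `d`, and game chromatic number exactly `5`. -/
theorem statement0 (d k : ℕ) (hd : 0 < d) (hk : 0 < k) :
    ∃ (V : Type) (_ : Fintype V) (_ : DecidableEq V) (CT : SimpleGraph V),
      IsCactus CT ∧ (k : ℕ∞) ≤ CT.egirth ∧ (d : ℕ∞) ≤ cycleDistance CT ∧
        gameChromaticNumber CT = 5 := by
  refine ⟨_, inferInstance, inferInstance,
    cactus (2 * k + 3) (2 * k + 3 + d) (16 * (2 * k + 3 + d)) _, isCactus_cactus (by omega)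
    (by omega), le_egirth_cactus (by omega) (by omega) (by omega),
    le_cycleDistance_cactus (by omega) rfl,
    gameChromaticNumber_cactus (by omega) (by omega) (by omega) le_rfl⟩
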